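/- Let N ⊆ M be an inclusion of II₁ factors of finite Jones index λ^{-1} = [M : N], written as the weak closure of N = ∪_n N_n with N_n ≅ M_{2^n}(ℂ) and N = N_n ⊗̄ (N_n' ∩ N), and let ω be a free ultrafilter on ℕ. Then there exists a projection e^ω ∈ N' ∩ M^ω with E_{N^ω}(e^ω) = λ·1; namely, for each n one can choose a projection e_n ∈ N_n' ∩ M with E_{N_n' ∩ N}(e_n) = λ·1 (so E_N(e_n) = λ·1), and e^ω = (e_n)_n works. -/

import Mathlib

open scoped ComplexOrder
open Filter

namespace PopaQ

variable {H : Type u} [NormedAddCommGroup H] [InnerProductSpace ℂ H] [CompleteSpace H]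

/-- Bounded operators on `H`. -/
abbrev Op (H : Type u) [NormedAddCommGroup H] [InnerProductSpace ℂ H] [CompleteSpace H] :=
  H →L[ℂ] H

/-- The relative commutant `N' ∩ M` (as sets of operators). -/
def relComm (N M : Set (Op H)) : Set (Op H) :=
  {x | x ∈ M ∧ ∀ y ∈ N, y * x = x * y}

/-- The scalar operators `ℂ 1`. -/
def scalars (H : Type u) [NormedAddCommGroup H] [InnerProductSpace ℂ H] [CompleteSpace H] :
    Set (Op H) :=
  {x | ∃ c : ℂ, x = c • (1 : Op H)}

/-- A (self-adjoint) projection. -/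
def IsProjection (p : Op H) : Prop :=
  IsSelfAdjoint p ∧ IsIdempotentElem p

/-- `τ` is a faithful tracial state on `M`. -/
structure IsTracialState (M : Set (Op H)) (τ : Op H →ₗ[ℂ] ℂ) : Prop where
  map_one : τ 1 = 1
  tracial : ∀ x ∈ M, ∀ y ∈ M, τ (x * y) = τ (y * x)
  pos : ∀ x ∈ M, 0 ≤ τ (star x * x)
  faithful : ∀ x ∈ M, τ (star x * x) = 0 → x = 0

/-- A set of operators is finite dimensional as a complex vector space. -/
def FinDim (S : Set (Op H)) : Prop :=
  ∃ s : Finset (Op H), S ⊆ (Submodule.span ℂ (s : Set (Op H)) : Set (Op H))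

/-- `M` is a II₁ factor with faithful normal trace `τ`:
a factor (trivial center) carrying a faithful tracial state, which is
infinite dimensional. -/
structure IsII1Factor (M : VonNeumannAlgebra H) (τ : Op H →ₗ[ℂ] ℂ) : Prop where
  factor : relComm (M : Set (Op H)) (M : Set (Op H)) = scalars H
  trace : IsTracialState (M : Set (Op H)) τ
  infdim : ¬ FinDim (M : Set (Op H))

/-- `M` is hyperfinite: it is the (weak closure = double commutant) of an increasing
union of finite-dimensional *-subalgebras. -/
def IsHyperfinite (M : VonNeumannAlgebra H) : Prop :=
  ∃ A : ℕ → StarSubalgebra ℂ (Op H),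
    Monotone A ∧ (∀ n, (A n : Set (Op H)) ⊆ M) ∧ (∀ n, FinDim (A n : Set (Op H))) ∧
    Set.centralizer (Set.centralizer (⋃ n, (A n : Set (Op H)))) = (M : Set (Op H))

/-- A bounded sequence of operators. -/
def Bdd (x : ℕ → Op H) : Prop :=
  ∃ C : ℝ, ∀ n, ‖x n‖ ≤ C

/-- A sequence taking values in `S`. -/
def SeqIn (S : Set (Op H)) (x : ℕ → Op H) : Prop :=
  ∀ n, x n ∈ S

/-- A free ultrafilter on ℕ. -/
def IsFreeUltrafilter (ω : Ultrafilter ℕ) : Prop :=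
  ∀ s : Set ℕ, s.Finite → s ∉ ω

/-- `Mω` is the tracial ultrapower of `M` along `ω`, with trace `τ`;
`limω` assigns to each bounded sequence in `M` its class in `Mω` (the diagonal
embedding of `M` into `Mω` being the identity on `M`). -/
structure IsTracialUltrapower (ω : Ultrafilter ℕ) (M Mω : VonNeumannAlgebra H)
    (τ : Op H →ₗ[ℂ] ℂ) (limω : (ℕ → Op H) → Op H) : Prop where
  subset : (M : Set (Op H)) ⊆ (Mω : Set (Op H))
  mem : ∀ x, SeqIn (M : Set (Op H)) x → Bdd x → limω x ∈ Mω
  diag : ∀ m ∈ M, limω (fun _ => m) = m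
  map_add : ∀ x y, SeqIn (M : Set (Op H)) x → Bdd x → SeqIn (M : Set (Op H)) y → Bdd y →
    limω (fun n => x n + y n) = limω x + limω y
  map_mul : ∀ x y, SeqIn (M : Set (Op H)) x → Bdd x → SeqIn (M : Set (Op H)) y → Bdd y →
    limω (fun n => x n * y n) = limω x * limω y
  map_smul : ∀ (c : ℂ) x, SeqIn (M : Set (Op H)) x → Bdd x →
    limω (fun n => c • x n) = c • limω x
  map_star : ∀ x, SeqIn (M : Set (Op H)) x → Bdd x →
    limω (fun n => star (x n)) = star (limω x)
  surj : ∀ z ∈ Mω, ∃ x, SeqIn (M : Set (Op H)) x ∧ Bdd x ∧ limω x = z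
  tr : ∀ x, SeqIn (M : Set (Op H)) x → Bdd x →
    Tendsto (fun n => τ (x n)) (ω : Filter ℕ) (nhds (τ (limω x)))
  eq_zero : ∀ x, SeqIn (M : Set (Op H)) x → Bdd x →
    (limω x = 0 ↔ Tendsto (fun n => ‖τ (star (x n) * x n)‖) (ω : Filter ℕ) (nhds 0))
  traceState : IsTracialState (Mω : Set (Op H)) τ

/-- The ultrapower `N^ω ⊆ M^ω` of a subalgebra `N ⊆ M`: classes of bounded
sequences with entries in `N`. -/
def ultrapowerSet (limω : (ℕ → Op H) → Op H) (N : Set (Op H)) : Set (Op H) :=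
  {z | ∃ x, SeqIn N x ∧ Bdd x ∧ limω x = z}

/-- `θ` is a *-homomorphism from `S` to `T` (as sets of operators). -/
def IsStarHomOn (θ : Op H → Op H) (S T : Set (Op H)) : Prop :=
  (∀ x ∈ S, θ x ∈ T) ∧
  (∀ x ∈ S, ∀ y ∈ S, θ (x + y) = θ x + θ y) ∧
  (∀ x ∈ S, ∀ y ∈ S, θ (x * y) = θ x * θ y) ∧
  (∀ (c : ℂ), ∀ x ∈ S, θ (c • x) = c • θ x) ∧
  (∀ x ∈ S, θ (star x) = star (θ x))

/-- The corner `p S p` of a set of operators. -/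
def corner (p : Op H) (S : Set (Op H)) : Set (Op H) :=
  {x | x ∈ S ∧ p * x * p = x}

/-- Popa's intertwining relation: a corner of `P` embeds into `Q` inside `M`,
written `P ≺_M Q`: there are nonzero projections `p ∈ P`, `q ∈ Q`, a
*-homomorphism `θ : pPp → qQq` and a nonzero partial isometry `v ∈ qMp` with
`θ(x) v = v x` for all `x ∈ pPp`. -/
def CornerEmbeds (P Q M : Set (Op H)) : Prop :=
  ∃ (p q v : Op H) (θ : Op H → Op H),
    p ∈ P ∧ IsProjection p ∧ p ≠ 0 ∧
    q ∈ Q ∧ IsProjection q ∧ q ≠ 0 ∧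
    IsStarHomOn θ (corner p P) (corner q Q) ∧
    v ∈ M ∧ v ≠ 0 ∧ IsProjection (star v * v) ∧ q * v * p = v ∧
    ∀ x ∈ corner p P, θ x * v = v * x

/-- `E` is the (`τ`-preserving) conditional expectation from `M` onto `Q`. -/
structure IsCondExp (τ : Op H →ₗ[ℂ] ℂ) (M Q : Set (Op H)) (E : Op H → Op H) : Prop where
  mem : ∀ x ∈ M, E x ∈ Q
  fix : ∀ q ∈ Q, E q = q
  map_add : ∀ x ∈ M, ∀ y ∈ M, E (x + y) = E x + E y
  map_smul : ∀ (c : ℂ), ∀ x ∈ M, E (c • x) = c • E x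
  bimod : ∀ a ∈ Q, ∀ x ∈ M, ∀ b ∈ Q, E (a * x * b) = a * E x * b
  tr : ∀ x ∈ M, τ (E x) = τ x

/-- `c` is a Pimsner–Popa bound for the inclusion `Q ⊆ M` with conditional
expectation `E`: every positive `x ∈ M` satisfies `x ≤ c E(x)`. -/
def IndexBound (M : Set (Op H)) (E : Op H → Op H) (c : ℝ) : Prop :=
  ∀ x ∈ M, x.IsPositive → (c • E x - x).IsPositive

/-- The inclusion `Q ⊆ M` (with conditional expectation `E`) has finite Jones index. -/
def HasFiniteIndex (M : Set (Op H)) (E : Op H → Op H) : Prop :=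
  ∃ c : ℝ, 0 < c ∧ IndexBound M E c

/-- The Jones index `[M : Q]` of an inclusion `Q ⊆ M` with conditional expectation `E`,
via the Pimsner–Popa characterization as the optimal constant `c` with
`x ≤ c E(x)` for all positive `x ∈ M`. -/
noncomputable def jonesIndex (M : Set (Op H)) (E : Op H → Op H) : ℝ :=
  sInf {c : ℝ | 0 < c ∧ IndexBound M E c}

theorem bb {α : Type*} (R : α → α → Prop) (hr : ∀ a, R a a) (ht : ∀ a b c, R a b → R b c → R a c)
    (φ : α → ℝ) (C : ℝ) (hC : ∀ a, φ a ≤ C) (hm : ∀ a b, R a b → φ a ≤ φ b)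
    (ub : ∀ s : ℕ → α, (∀ k, R (s k) (s (k + 1))) → ∃ u, ∀ k, R (s k) u) (a0 : α) :
    ∃ a, R a0 a ∧ ∀ b, R a b → φ b ≤ φ a := by
  let S : α → ℝ := fun a => sSup (φ '' {b | R a b})
  have bdd : ∀ a, BddAbove (φ '' {b | R a b}) := fun a =>
    ⟨C, by rintro _ ⟨b, _, rfl⟩; exact hC b⟩
  have hS : ∀ a b, R a b → φ b ≤ S a := fun a b hb => le_csSup (bdd a) ⟨b, hb, rfl⟩
  have hSm : ∀ a b, R a b → S b ≤ S a := by
    intro a b hab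
    refine csSup_le ⟨_, b, hr b, rfl⟩ ?_
    rintro _ ⟨d, hd, rfl⟩
    exact hS a d (ht _ _ _ hab hd)
  have nxt : ∀ a, ∃ b, R a b ∧ S a - φ b ≤ (S a - φ a) / 2 := by
    intro a
    rcases (hS a a (hr a)).lt_or_eq with h | h
    · obtain ⟨_, ⟨b, hb, rfl⟩, hlt⟩ := exists_lt_of_lt_csSup (s := φ '' {b | R a b})
        ⟨_, a, hr a, rfl⟩ (show (S a + φ a) / 2 < sSup (φ '' {b | R a b}) by
          change _ < S a
          linarith)
      exact ⟨b, hb, by linarith⟩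
    · exact ⟨a, hr a, by linarith⟩
  choose nx hn1 hn2 using nxt
  let s : ℕ → α := fun k => nx^[k] a0
  have hs : ∀ k, s (k + 1) = nx (s k) := fun k => Function.iterate_succ_apply' nx k a0
  obtain ⟨u, hu⟩ := ub s (fun k => by rw [hs]; exact hn1 _)
  refine ⟨u, hu 0, fun b hb => ?_⟩
  have hD : ∀ k, S (s k) - φ (s k) ≤ (S a0 - φ a0) * (1 / 2) ^ k := by
    intro k
    induction k with
    | zero => simp [s]
    | succ k ih =>
      have h1 := hn2 (s k)
      have h2 := hSm _ _ (hn1 (s k))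
      rw [hs, pow_succ]
      linarith
  have hlim : Tendsto (fun k : ℕ => (S a0 - φ a0) * (1 / 2 : ℝ) ^ k) atTop (nhds 0) := by
    simpa using (tendsto_pow_atTop_nhds_zero_of_lt_one (r := (1/2 : ℝ)) (by norm_num)
      (by norm_num)).const_mul (S a0 - φ a0)
  have : φ b - φ u ≤ 0 := by
    refine ge_of_tendsto' hlim (fun k => ?_)
    have h1 := hS (s k) b (ht _ _ _ (hu k) hb)
    have h2 := hm _ _ (hu k)
    linarith [hD k]
  linarith

theorem mem_of_comm (M : VonNeumannAlgebra H) {x : Op H}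
    (h : ∀ y ∈ M.commutant, y * x = x * y) : x ∈ M := by
  rw [← VonNeumannAlgebra.commutant_commutant M, VonNeumannAlgebra.mem_commutant_iff]
  exact h

theorem comm_of_mem (M : VonNeumannAlgebra H) {x y : Op H} (hx : x ∈ M) (hy : y ∈ M.commutant) :
    y * x = x * y :=
  ((VonNeumannAlgebra.mem_commutant_iff.1 hy) x hx).symm

theorem smul_mem' (M : VonNeumannAlgebra H) (c : ℂ) {x : Op H} (hx : x ∈ M) : c • x ∈ M :=
  M.toStarSubalgebra.smul_mem hx c

theorem rsmul_mem' (M : VonNeumannAlgebra H) (c : ℝ) {x : Op H} (hx : x ∈ M) : c • x ∈ M := by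
  have := smul_mem' M (c : ℂ) hx
  rwa [Complex.coe_smul] at this

theorem lim_mem (M : VonNeumannAlgebra H) (T : ℕ → Op H) (S : Op H) (hT : ∀ k, T k ∈ M)
    (h : ∀ v, Tendsto (fun k => T k v) atTop (nhds (S v))) : S ∈ M := by
  refine mem_of_comm M fun y hy => ?_
  ext v
  have h1 : Tendsto (fun k => y (T k v)) atTop (nhds (y (S v))) :=
    (y.continuous.tendsto _).comp (h v)
  have h2 := h (y v)
  refine tendsto_nhds_unique h1 (h2.congr fun k => ?_)
  exact (congrArg (fun z : Op H => z v) (comm_of_mem M (hT k) hy)).symm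

theorem cfc_mem (M : VonNeumannAlgebra H) {a : Op H} (ha : a ∈ M) (f : ℝ → ℝ) :
    cfc f a ∈ M := by
  refine mem_of_comm M fun y hy => ?_
  have : Commute a y := (comm_of_mem M ha hy).symm
  exact (this.cfc_real f).symm

theorem cfcn_mem (M : VonNeumannAlgebra H) {a : Op H} (ha : a ∈ M) (f : ℝ → ℝ) :
    cfcₙ f a ∈ M := by
  refine mem_of_comm M fun y hy => ?_
  have : Commute a y := (comm_of_mem M ha hy).symm
  exact (this.cfcₙ_real f).symm

theorem exists_sqrt (M : VonNeumannAlgebra H) {a : Op H} (ha : a ∈ M) (hp : a.IsPositive) :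
    ∃ x ∈ M, star x = x ∧ star x * x = a := by
  have h0 : 0 ≤ a := (ContinuousLinearMap.nonneg_iff_isPositive a).2 hp
  have hs : IsSelfAdjoint (CFC.sqrt a) := (CFC.sqrt_nonneg a).isSelfAdjoint
  refine ⟨CFC.sqrt a, ?_, hs, ?_⟩
  · rw [CFC.sqrt_eq_real_sqrt a]; exact cfcn_mem M ha _
  · rw [hs.star_eq]; exact CFC.sqrt_mul_sqrt_self a

theorem starProj_mem (M : VonNeumannAlgebra H) (K : Submodule ℂ H) [K.HasOrthogonalProjection]
    (h : ∀ y ∈ M.commutant, ∀ v ∈ K, y v ∈ K) : K.starProjection ∈ M := by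
  rw [VonNeumannAlgebra.IsStarProjection.mem_iff isStarProjection_starProjection]
  intro y hy
  rw [Submodule.range_starProjection]
  exact fun v hv => h y hy v hv

theorem IsProjection.starProj {p : Op H} (h : IsProjection p) : IsStarProjection p := ⟨h.2, h.1⟩

theorem isProj_starProj (K : Submodule ℂ H) [K.HasOrthogonalProjection] :
    IsProjection K.starProjection :=
  ⟨isStarProjection_starProjection.isSelfAdjoint, isStarProjection_starProjection.isIdempotentElem⟩

theorem isProj_of {p : Op H} (h1 : star p = p) (h2 : p * p = p) : IsProjection p := ⟨h1, h2⟩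

theorem IsProjection.st {p : Op H} (h : IsProjection p) : star p = p := h.1
theorem IsProjection.sq {p : Op H} (h : IsProjection p) : p * p = p := h.2

theorem IsProjection.compl {p : Op H} (h : IsProjection p) : IsProjection (1 - p) :=
  isProj_of (by simp [h.st]) (by simp [mul_sub, sub_mul, h.sq])

theorem star_inner (a : Op H) (v w : H) : inner ℂ (star a v) w = inner ℂ v (a w) := by
  rw [ContinuousLinearMap.star_eq_adjoint, ContinuousLinearMap.adjoint_inner_left]

theorem inner_star_mul (a : Op H) (v : H) :
    (inner ℂ ((star a * a) v) v).re = ‖a v‖ ^ 2 := by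
  rw [mul_apply_eq_comp, star_inner]
  exact inner_self_eq_norm_sq (𝕜 := ℂ) _

theorem star_mul_eq_zero {a : Op H} (h : star a * a = 0) : a = 0 := by
  exact CStarRing.star_mul_self_eq_zero_iff a |>.1 h

theorem isPos_star_mul (a : Op H) : (star a * a).IsPositive :=
  (ContinuousLinearMap.nonneg_iff_isPositive _).1 (star_mul_self_nonneg a)

/-- Increasing sequences of projections converge strongly. -/
theorem proj_lim (p : ℕ → Op H) (hp : ∀ k, IsProjection (p k))
    (hm : ∀ k, p (k + 1) * p k = p k) :
    ∃ P : Op H, IsProjection P ∧ (∀ v, Tendsto (fun k => p k v) atTop (nhds (P v))) ∧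
      (∀ k, P * p k = p k) ∧ (∀ k m, k ≤ m → p m * p k = p k) := by
  have hmm : ∀ k m, k ≤ m → p m * p k = p k := by
    intro k m hkm
    induction m, hkm using Nat.le_induction with
    | base => exact (hp k).sq
    | succ m _ ih => rw [← ih, ← mul_assoc, hm m]
  let U : ℕ → Submodule ℂ H := fun k => (p k).range
  have hU : ∀ k, ∃ _ : (U k).HasOrthogonalProjection, p k = (U k).starProjection := fun k =>
    isStarProjection_iff_eq_starProjection_range.1 (hp k).starProj
  choose i hi using hU
  have := i
  have hmono : Monotone U := by
    intro k m hkm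
    rintro _ ⟨v, rfl⟩
    exact ⟨p k v, congrArg (fun z : Op H => z v) (hmm k m hkm)⟩
  have hconv : ∀ v, Tendsto (fun k => p k v) atTop
      (nhds ((⨆ i, U i).topologicalClosure.starProjection v)) := by
    intro v
    refine (Submodule.starProjection_tendsto_closure_iSup U hmono v).congr fun k => ?_
    rw [hi k]
  refine ⟨_, isProj_starProj _, hconv, fun k => ?_, hmm⟩
  ext v
  refine tendsto_nhds_unique (hconv (p k v)) ?_
  refine tendsto_const_nhds.congr' ?_
  filter_upwards [eventually_ge_atTop k] with m hkm
  exact (congrArg (fun z : Op H => z v) (hmm k m hkm)).symm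

/-- bounded-by-projection Cauchy -/
theorem op_lim (T : ℕ → Op H) (hT : ∀ v, CauchySeq (fun k => T k v)) :
    ∃ S : Op H, ∀ v, Tendsto (fun k => T k v) atTop (nhds (S v)) := by
  choose g hg using fun v => cauchySeq_tendsto_of_complete (hT v)
  refine ⟨continuousLinearMapOfTendsto (σ₁₂ := RingHom.id ℂ) T (f := g)
    (tendsto_pi_nhds.2 hg), hg⟩

/-- Normalisation. -/
theorem normalize (M : VonNeumannAlgebra H) {b : Op H} (hb : b ∈ M) (hp : b.IsPositive)
    (h0 : b ≠ 0) : ∃ n ∈ M, ∃ s ∈ M, IsProjection s ∧ s ≠ 0 ∧ star n * b * n = s ∧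
      ∀ f : Op H, f * b = 0 → f * s = 0 := by
  have hb0 : 0 ≤ b := (ContinuousLinearMap.nonneg_iff_isPositive b).2 hp
  have hsa : IsSelfAdjoint b := hb0.isSelfAdjoint
  set ε : ℝ := ‖b‖ / 2 with hε
  have hn0 : 0 < ‖b‖ := norm_pos_iff.2 h0
  have hε0 : 0 < ε := by positivity
  let k : Op H := cfc (fun t : ℝ => max (t - ε) 0) b
  let g : Op H := cfc (fun t : ℝ => (Real.sqrt (max t ε))⁻¹) b
  have hgc : Continuous (fun t : ℝ => (Real.sqrt (max t ε))⁻¹) := by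
    refine Continuous.inv₀ (by fun_prop) fun t => ?_
    have : 0 < max t ε := lt_max_of_lt_right hε0
    positivity
  have hkM : k ∈ M := cfc_mem M hb _
  have hgM : g ∈ M := cfc_mem M hb _
  have hksa : IsSelfAdjoint k := cfc_predicate _ b
  have hgsa : IsSelfAdjoint g := cfc_predicate _ b
  have hk0 : k ≠ 0 := by
    intro hk
    have h1 : b = cfc (fun t : ℝ => min t ε) b + k := by
      simp only [k]
      rw [← cfc_add (R := ℝ) (a := b) (fun t : ℝ => min t ε) (fun t : ℝ => max (t - ε) 0)]
      conv_lhs => rw [← cfc_id ℝ b]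
      refine cfc_congr fun t _ => ?_
      simp only [id]
      rcases le_total t ε with h | h
      · rw [min_eq_left h, max_eq_right (by linarith)]; ring
      · rw [min_eq_right h, max_eq_left (by linarith)]; ring
    rw [hk, add_zero] at h1
    have h2 : ‖cfc (fun t : ℝ => min t ε) b‖ ≤ ε := by
      refine norm_cfc_le hε0.le fun t ht => ?_
      have ht0 : 0 ≤ t := spectrum_nonneg_of_nonneg hb0 ht
      rw [Real.norm_of_nonneg (le_min ht0 hε0.le)]
      exact min_le_right _ _
    rw [← h1] at h2
    linarith
  let K : Submodule ℂ H := k.ker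
  have : CompleteSpace K := (k.isClosed_ker).completeSpace_coe
  let P : Op H := K.starProjection
  have hPM : P ∈ M := by
    refine starProj_mem M K fun y hy v hv => ?_
    have h1 : k (y v) = y (k v) :=
      (congrArg (fun z : Op H => z v) (comm_of_mem M hkM hy)).symm
    have h2 : k v = 0 := hv
    change k (y v) = 0
    rw [h1, h2, map_zero]
  have hPp : IsProjection P := isProj_starProj K
  have hkP : k * P = 0 := by
    ext v
    exact (Submodule.starProjection_apply_mem K v : P v ∈ K)
  have hker : ∀ x : Op H, k * x = 0 → P * x = x := by
    intro x hx
    ext v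
    refine Submodule.starProjection_eq_self_iff.2 ?_
    exact congrArg (fun z : Op H => z v) hx
  have hks : k * (1 - P) = k := by rw [mul_sub, mul_one, hkP, sub_zero]
  have hsp := hPp.compl
  have hcanc : ∀ x : Op H, k * x = 0 → (1 - P) * x = 0 := fun x hx => by
    rw [sub_mul, one_mul, hker x hx, sub_self]
  have hgg : k * (g * b * g - 1) = 0 := by
    have e1 : g * b * g - 1 = cfc (fun t : ℝ => (Real.sqrt (max t ε))⁻¹ * t *
        (Real.sqrt (max t ε))⁻¹ - 1) b := by
      rw [cfc_sub (R := ℝ) (a := b) (fun t : ℝ => (Real.sqrt (max t ε))⁻¹ * t *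
        (Real.sqrt (max t ε))⁻¹) (fun _ => 1) ((hgc.mul continuous_id').mul hgc).continuousOn (by fun_prop), cfc_mul (R := ℝ)
        (a := b) (fun t : ℝ => (Real.sqrt (max t ε))⁻¹ * t) (fun t => (Real.sqrt (max t ε))⁻¹)
        (hgc.mul continuous_id').continuousOn hgc.continuousOn, cfc_mul (R := ℝ) (a := b)
        (fun t : ℝ => (Real.sqrt (max t ε))⁻¹) (fun t => t) hgc.continuousOn (by fun_prop),
        cfc_const_one ℝ b]
      congr 3
      rw [cfc_id' ℝ b]
    rw [e1]
    simp only [k]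
    have hcc : Continuous (fun t : ℝ => (Real.sqrt (max t ε))⁻¹ * t *
        (Real.sqrt (max t ε))⁻¹ - 1) := ((hgc.mul continuous_id').mul hgc).sub continuous_const
    rw [← cfc_mul (R := ℝ) (a := b) (fun t : ℝ => max (t - ε) 0) (fun t : ℝ =>
      (Real.sqrt (max t ε))⁻¹ * t * (Real.sqrt (max t ε))⁻¹ - 1) (by fun_prop)
      hcc.continuousOn, ← cfc_const_zero ℝ b]
    refine cfc_congr fun t _ => ?_
    try simp only
    rcases le_total t ε with h | h
    · rw [max_eq_right (by linarith), zero_mul]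
    · rw [max_eq_left h]
      have ht : 0 < t := by linarith
      have : (Real.sqrt t)⁻¹ * t * (Real.sqrt t)⁻¹ = 1 := by
        have h3 := Real.mul_self_sqrt ht.le
        have h4 : Real.sqrt t ≠ 0 := by positivity
        field_simp
        rw [sq, h3]
      rw [this]; ring
  refine ⟨g * (1 - P), mul_mem hgM (sub_mem (one_mem M) hPM), 1 - P,
    sub_mem (one_mem M) hPM, hsp, ?_, ?_, ?_⟩
  · intro h
    rw [h, mul_zero] at hks
    exact hk0 hks.symm
  · rw [star_mul, hsp.st, hgsa.star_eq]
    have := hcanc _ hgg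
    have h2 : (1 - P) * (g * b * g) = 1 - P := by
      rw [mul_sub, mul_one] at this
      exact sub_eq_zero.1 this
    calc (1 - P) * g * b * (g * (1 - P)) = (1 - P) * (g * b * g) * (1 - P) := by noncomm_ring
      _ = _ := by rw [h2, hsp.sq]
  · intro f hf
    have hbf : b * star f = 0 := by
      have := congrArg star hf
      rwa [star_mul, hsa.star_eq, star_zero] at this
    have hkb : ∃ r : Op H, k = r * b := by
      refine ⟨cfc (fun t : ℝ => max (t - ε) 0 / max t ε) b, ?_⟩
      have hc : Continuous (fun t : ℝ => max (t - ε) 0 / max t ε) := by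
        refine Continuous.div (by fun_prop) (by fun_prop) fun t => ?_
        have : 0 < max t ε := lt_max_of_lt_right hε0
        positivity
      conv_rhs => rw [← cfc_id' ℝ b]
      simp only [k]
      rw [cfc_id' ℝ b]
      conv_rhs => arg 2; rw [← cfc_id' ℝ b]
      rw [← cfc_mul (R := ℝ) (a := b) _ _ hc.continuousOn (by fun_prop)]
      refine cfc_congr fun t _ => ?_
      try simp only
      rcases le_total t ε with h | h
      · rw [max_eq_right (by linarith)]; simp
      · rw [max_eq_left h]
        have ht : t ≠ 0 := by linarith
        field_simp
    obtain ⟨r, hr⟩ := hkb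
    have h3 : k * star f = 0 := by rw [hr, mul_assoc, hbf, mul_zero]
    have := congrArg star (hcanc _ h3)
    rwa [star_mul, star_star, hsp.st, star_zero] at this

theorem prime_of_factor (M : VonNeumannAlgebra H)
    (hf : relComm (M : Set (Op H)) (M : Set (Op H)) = scalars H) {a b : Op H} (ha : a ∈ M)
    (h : ∀ x ∈ M, a * x * b = 0) : a = 0 ∨ b = 0 := by
  let K : Submodule ℂ H :=
    { carrier := {v | ∀ x ∈ M, a (x v) = 0}
      add_mem' := fun {v w} hv hw x hx => by rw [map_add, map_add, hv x hx, hw x hx, add_zero]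
      zero_mem' := fun x _ => by simp
      smul_mem' := fun c v hv x hx => by rw [map_smul, map_smul, hv x hx, smul_zero] }
  have hcl : IsClosed (K : Set H) := by
    have : (K : Set H) = ⋂ x ∈ M, {v | a (x v) = 0} := by
      ext v; simp [K]
    rw [this]
    refine isClosed_biInter fun x _ => isClosed_eq (by fun_prop) continuous_const
  have : CompleteSpace K := hcl.completeSpace_coe
  have h1 : K.starProjection ∈ M := by
    refine starProj_mem M K fun y hy v hv x hx => ?_
    have e := congrArg (fun z : Op H => z v) (comm_of_mem M (mul_mem ha hx) hy)
    have e' : y (a (x v)) = a (x (y v)) := e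
    rw [← e', hv x hx, map_zero]
  have h2 : K.starProjection ∈ M.commutant := by
    refine starProj_mem _ K fun y hy v hv x hx => ?_
    rw [VonNeumannAlgebra.commutant_commutant] at hy
    exact hv (x * y) (mul_mem hx hy)
  have h3 : K.starProjection ∈ scalars H := by
    rw [← hf]
    exact ⟨h1, fun y hy => (comm_of_mem M hy h2).symm⟩
  obtain ⟨c, hc⟩ := h3
  by_cases hc0 : c = 0
  · right
    ext v
    have : b v ∈ K := fun x hx => congrArg (fun z : Op H => z v) (h x hx)
    have := Submodule.starProjection_eq_self_iff.2 this
    rw [hc, hc0] at this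
    simpa using this.symm
  · left
    ext v
    have : K.starProjection v ∈ K := Submodule.starProjection_apply_mem K v
    rw [hc] at this
    have h4 := this 1 (one_mem M)
    simpa [hc0] using h4

section tr
variable {M : VonNeumannAlgebra H} {τ : Op H →ₗ[ℂ] ℂ}

theorem tr_pos (hτ : IsTracialState (M : Set (Op H)) τ) {a : Op H} (ha : a ∈ M)
    (hp : a.IsPositive) : 0 ≤ (τ a).re ∧ (τ a).im = 0 := by
  obtain ⟨x, hx, _, rfl⟩ := exists_sqrt M ha hp
  have := hτ.pos x hx
  rw [Complex.nonneg_iff] at this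
  exact ⟨this.1, this.2.symm⟩

theorem tr_pos_zero (hτ : IsTracialState (M : Set (Op H)) τ) {a : Op H} (ha : a ∈ M)
    (hp : a.IsPositive) (h0 : (τ a).re = 0) : a = 0 := by
  have him := (tr_pos hτ ha hp).2
  obtain ⟨x, hx, _, rfl⟩ := exists_sqrt M ha hp
  have := hτ.faithful x hx (Complex.ext h0 him)
  rw [this, mul_zero]

theorem proj_pos {p : Op H} (h : IsProjection p) : p.IsPositive := by
  have := isPos_star_mul p
  rwa [h.st, h.sq] at this

theorem tr_proj_pos (hτ : IsTracialState (M : Set (Op H)) τ) {p : Op H} (hp : p ∈ M)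
    (h : IsProjection p) (h0 : p ≠ 0) : 0 < (τ p).re := by
  refine lt_of_le_of_ne (tr_pos hτ hp (proj_pos h)).1 fun h1 => h0 ?_
  exact tr_pos_zero hτ hp (proj_pos h) h1.symm

theorem tr_real (hτ : IsTracialState (M : Set (Op H)) τ) {p : Op H} (hp : p ∈ M)
    (h : p.IsPositive) : τ p = ((τ p).re : ℂ) := by
  apply Complex.ext
  · simp
  · simpa using (tr_pos hτ hp h).2

theorem tr_star (hτ : IsTracialState (M : Set (Op H)) τ) {x : Op H} (hx : x ∈ M) :
    τ (star x) = star (τ x) := by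
  have key : ∀ c : ℂ, (c * τ (star x) + star c * τ x).im = 0 := by
    intro c
    have hc : c • (1 : Op H) ∈ M := smul_mem' M c (one_mem M)
    have h1 := hτ.pos _ (add_mem hx hc)
    have h2 := hτ.pos _ hx
    have e : star (x + c • (1 : Op H)) * (x + c • (1 : Op H)) =
        star x * x + c • star x + star c • x + (star c * c) • 1 := by
      rw [star_add, star_smul, star_one, add_mul, mul_add, mul_add, smul_mul_smul_comm, mul_one,
        mul_smul_comm, mul_one, smul_mul_assoc, one_mul]
      abel
    rw [e] at h1
    simp only [map_add, map_smul, hτ.map_one, smul_eq_mul] at h1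
    rw [Complex.nonneg_iff] at h1 h2
    have h3 := h1.2
    have h4 := h2.2
    simp only [Complex.add_im, Complex.mul_im, Complex.star_def, Complex.conj_re,
      Complex.conj_im, Complex.one_re, Complex.one_im, Complex.mul_re] at h3 ⊢
    linarith
  have k1 := key 1
  have k2 := key Complex.I
  simp at k1 k2
  apply Complex.ext
  · simp; linarith
  · simp; linarith

theorem isPos_posPart (a : Op H) : (a⁺).IsPositive :=
  (ContinuousLinearMap.nonneg_iff_isPositive _).1 (CFC.posPart_nonneg a)

theorem isPos_negPart (a : Op H) : (a⁻).IsPositive :=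
  (ContinuousLinearMap.nonneg_iff_isPositive _).1 (CFC.negPart_nonneg a)

theorem posPart_mem {a : Op H} (ha : a ∈ M) : a⁺ ∈ M := cfcn_mem M ha _
theorem negPart_mem {a : Op H} (ha : a ∈ M) : a⁻ ∈ M := cfcn_mem M ha _

/-- a trace zero selfadjoint with a zero positive or negative part vanishes -/
theorem tr_zero_part (hτ : IsTracialState (M : Set (Op H)) τ) {z : Op H} (hz : z ∈ M)
    (hsa : IsSelfAdjoint z) (h0 : τ z = 0) (h : z⁺ = 0 ∨ z⁻ = 0) : z = 0 := by
  have e := CFC.posPart_sub_negPart z hsa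
  have e2 : τ (z⁺) - τ (z⁻) = 0 := by rw [← map_sub, e, h0]
  rcases h with h | h
  · rw [h, map_zero, zero_sub, neg_eq_zero] at e2
    have := tr_pos_zero hτ (negPart_mem hz) (isPos_negPart z) (by rw [e2]; simp)
    rw [← e, h, this, sub_zero]
  · rw [h, map_zero, sub_zero] at e2
    have := tr_pos_zero hτ (posPart_mem hz) (isPos_posPart z) (by rw [e2]; simp)
    rw [← e, h, this, sub_zero]

theorem corner_scalar (hτ : IsTracialState (M : Set (Op H)) τ)
    (hprime : ∀ a ∈ M, ∀ b ∈ M, (∀ x ∈ M, a * x * b = 0) → a = 0 ∨ b = 0)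
    {q z : Op H} (hq : q ∈ M) (hqp : IsProjection q) (hz : z ∈ M) (hsa : IsSelfAdjoint z)
    (h1 : q * z = z) (h : ∀ x ∈ M, q * x * z = z * x * q) (t : ℝ) (ht : τ z = t * τ q) :
    z = (t : ℂ) • q := by
  have h2 : z * q = z := by
    have := congrArg star h1
    rwa [star_mul, hsa.star_eq, hqp.st] at this
  set w : Op H := z - (t : ℂ) • q with hw
  have hwM : w ∈ M := sub_mem hz (smul_mem' M _ hq)
  have hwsa : IsSelfAdjoint w := by
    change star w = w
    rw [hw, star_sub, star_smul, hsa.star_eq, hqp.st]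
    simp
  have hw0 : τ w = 0 := by rw [hw, map_sub, map_smul, ht, smul_eq_mul, sub_self]
  have hqw : q * w = w := by rw [hw, mul_sub, h1, mul_smul_comm, hqp.sq]
  have hwq : w * q = w := by rw [hw, sub_mul, h2, smul_mul_assoc, hqp.sq]
  have hwx : ∀ x ∈ M, q * x * w = w * x * q := by
    intro x hx
    rw [hw, mul_sub, sub_mul, sub_mul, h x hx, mul_smul_comm, smul_mul_assoc, smul_mul_assoc]
  have hcomm : ∀ x ∈ M, Commute w (q * x * q) := by
    intro x hx
    change w * (q * x * q) = q * x * q * w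
    rw [mul_assoc (q * x), hqw, hwx x hx, ← mul_assoc, ← mul_assoc, hwq]
  set a := w⁺ with ha
  set b := w⁻ with hb
  have hab : a * b = 0 := CFC.posPart_mul_negPart w
  have hba : b * a = 0 := CFC.negPart_mul_posPart w
  have e := CFC.posPart_sub_negPart w hwsa
  have hawa : a * w = a * a := by rw [← e, mul_sub, hab, sub_zero]
  have hwb : w * b = -(b * b) := by rw [← e, sub_mul, hab, zero_sub]
  have hwa : w * a = a * a := by rw [← e, sub_mul, hba, sub_zero]
  have hz0 : w = 0 := by
    apply tr_zero_part hτ hwM hwsa hw0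
    have := hprime (a * a) (mul_mem (posPart_mem hwM) (posPart_mem hwM)) (b * b)
      (mul_mem (negPart_mem hwM) (negPart_mem hwM)) (fun x hx => by
        have hca : Commute a (q * x * q) := by
          rw [ha]
          exact (hcomm x hx).cfcₙ_real _
        have h3 : a * w * (q * x * q) * (w * b) = 0 := by
          rw [hawa, hwb, mul_assoc a a, hca.eq, ← mul_assoc a, hca.eq]
          rw [mul_neg, mul_assoc, ← mul_assoc a b, hab]
          simp
        have h4 : a * w * (q * x * q) * (w * b) = a * (w * q) * x * (q * w) * b := by noncomm_ring
        rw [h4, hwq, hqw, hawa, mul_assoc _ w b, hwb, mul_neg, neg_eq_zero] at h3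
        exact h3)
    have hasa : star a = a := (CFC.posPart_nonneg w).isSelfAdjoint
    have hbsa : star b = b := (CFC.negPart_nonneg w).isSelfAdjoint
    rcases this with h5 | h5
    · left; exact star_mul_eq_zero (by rw [hasa]; exact h5)
    · right; exact star_mul_eq_zero (by rw [hbsa]; exact h5)
  rw [hw] at hz0
  exact sub_eq_zero.1 hz0

/-- halving -/
theorem halve {M1 : VonNeumannAlgebra H} (hτ : IsTracialState (M1 : Set (Op H)) τ)
    {p : Op H} (hp : p ∈ M1) (hpp : IsProjection p) (hp0 : p ≠ 0)
    (hd : ∃ x ∈ M1, ∀ t : ℂ, p * x * p ≠ t • p) :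
    ∃ s ∈ M1, IsProjection s ∧ s ≠ 0 ∧ p * s = s ∧ (τ s).re ≤ (τ p).re / 2 := by
  have hd' : ∃ x ∈ M1, star x = x ∧ ∀ t : ℂ, p * x * p ≠ t • p := by
    by_contra! hcon
    obtain ⟨x, hx, hxt⟩ := hd
    obtain ⟨t1, h1⟩ := hcon (x + star x) (add_mem hx (star_mem hx)) (by simp [add_comm])
    obtain ⟨t2, h2⟩ := hcon (Complex.I • (x - star x)) (smul_mem' _ _ (sub_mem hx (star_mem hx)))
      (by
        rw [star_smul, star_sub, star_star]
        simp [smul_sub]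
        abel)
    apply hxt ((1 / 2 : ℂ) * (t1 - Complex.I * t2))
    have e : x = (1 / 2 : ℂ) • ((x + star x) - Complex.I • (Complex.I • (x - star x))) := by
      rw [smul_smul, Complex.I_mul_I]
      module
    have : p * x * p = (1 / 2 : ℂ) • (p * (x + star x) * p -
        Complex.I • (p * (Complex.I • (x - star x)) * p)) := by
      conv_lhs => rw [e]
      simp only [mul_sub, sub_mul, mul_smul_comm, smul_mul_assoc]
    rw [this, h1, h2]
    module
  obtain ⟨x, hx, hxs, hxt⟩ := hd'
  set a : Op H := p * x * p with ha
  have haM : a ∈ M1 := mul_mem (mul_mem hp hx) hp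
  have hasa : star a = a := by rw [ha, star_mul, star_mul, hpp.st, hxs, mul_assoc]
  have hτp := tr_proj_pos hτ hp hpp hp0
  set t : ℝ := (τ a).re / (τ p).re with ht
  have hta : τ a = ((τ a).re : ℂ) := by
    have := tr_star hτ haM
    rw [hasa] at this
    exact (Complex.conj_eq_iff_real.1 this.symm).elim fun r hr => by rw [hr]; simp
  have htp := tr_real hτ hp (proj_pos hpp)
  set w : Op H := a - (t : ℂ) • p with hw
  have hwM : w ∈ M1 := sub_mem haM (smul_mem' _ _ hp)
  have hwsa : IsSelfAdjoint w := by
    change star w = w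
    rw [hw, star_sub, star_smul, hasa, hpp.st]; simp
  have hw0 : τ w = 0 := by
    rw [hw, map_sub, map_smul, hta, htp, ht, smul_eq_mul, ← Complex.ofReal_mul,
      div_mul_cancel₀ _ hτp.ne', sub_self]
  have hwne : w ≠ 0 := fun h => hxt t (sub_eq_zero.1 h)
  have hpw : p * w = w := by
    rw [hw, mul_sub, mul_smul_comm, hpp.sq, ha, ← mul_assoc, ← mul_assoc, hpp.sq]
  have hwp : w * p = w := by
    rw [hw, sub_mul, smul_mul_assoc, hpp.sq, ha, mul_assoc, hpp.sq]
  have hb0 : w⁺ ≠ 0 := fun h => hwne (tr_zero_part hτ hwM hwsa hw0 (Or.inl h))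
  have hc0 : w⁻ ≠ 0 := fun h => hwne (tr_zero_part hτ hwM hwsa hw0 (Or.inr h))
  have hab : w⁺ * w⁻ = 0 := CFC.posPart_mul_negPart w
  have hba : w⁻ * w⁺ = 0 := CFC.negPart_mul_posPart w
  have e := CFC.posPart_sub_negPart w hwsa
  have hpa : (1 - p) * w⁺ = 0 := by
    have h1 : (1 - p) * (w⁺ * w⁺) = 0 := by
      have : w * w⁺ = w⁺ * w⁺ := by
        conv_lhs => arg 1; rw [← e]
        rw [sub_mul, hba, sub_zero]
      rw [← this, ← mul_assoc, sub_mul, hpw, one_mul, sub_self, zero_mul]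
    have hs : star (w⁺) = w⁺ := (CFC.posPart_nonneg w).isSelfAdjoint
    have h2 : star (w⁺ * (1 - p)) * (w⁺ * (1 - p)) = 0 := by
      rw [star_mul, hs, hpp.compl.st, ← mul_assoc, mul_assoc (1 - p), h1, zero_mul]
    have h3 := congrArg star (star_mul_eq_zero h2)
    rwa [star_mul, hs, hpp.compl.st, star_zero] at h3
  obtain ⟨n, hn, s, hs, hsp, hs0, -, hf⟩ := normalize M1 (posPart_mem hwM) (isPos_posPart w) hb0
  have hps : p * s = s := by
    have := hf _ hpa
    rw [sub_mul, one_mul] at this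
    exact (sub_eq_zero.1 this).symm
  have hsp' : s * p = s := by
    have := congrArg star hps
    rwa [star_mul, hsp.st, hpp.st] at this
  have hns : w⁻ * s = 0 := hf _ hba
  have hpsne : p - s ≠ 0 := by
    intro h
    rw [← sub_eq_zero.1 h] at hns
    have h1 : w⁻ * w = -(w⁻ * w⁻) := by
      conv_lhs => arg 2; rw [← e]
      rw [mul_sub, hba, zero_sub]
    have h2 : w⁻ * w⁻ = 0 := by
      rw [← neg_eq_zero, ← h1]
      conv_lhs => arg 2; rw [← hpw]
      rw [← mul_assoc, hns, zero_mul]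
    have h3 : star (w⁻) = w⁻ := (CFC.negPart_nonneg w).isSelfAdjoint
    exact hc0 (star_mul_eq_zero (by rw [h3, h2]))
  have hpsp : IsProjection (p - s) := isProj_of (by rw [star_sub, hpp.st, hsp.st])
    (by rw [sub_mul, mul_sub, mul_sub, hpp.sq, hps, hsp', hsp.sq]; abel)
  by_cases hle : (τ s).re ≤ (τ p).re / 2
  · exact ⟨s, hs, hsp, hs0, hps, hle⟩
  · refine ⟨p - s, sub_mem hp hs, hpsp, hpsne, by rw [mul_sub, hpp.sq, hps], ?_⟩
    rw [map_sub, Complex.sub_re]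
    linarith

theorem small_proj {M1 : VonNeumannAlgebra H} (hτ : IsTracialState (M1 : Set (Op H)) τ)
    (hd : ∀ p ∈ M1, IsProjection p → p ≠ 0 → ∃ x ∈ M1, ∀ t : ℂ, p * x * p ≠ t • p)
    {p : Op H} (hp : p ∈ M1) (hpp : IsProjection p) (hp0 : p ≠ 0) (ε : ℝ) (hε : 0 < ε) :
    ∃ s ∈ M1, IsProjection s ∧ s ≠ 0 ∧ p * s = s ∧ (τ s).re < ε := by
  have key : ∀ k : ℕ, ∃ s ∈ M1, IsProjection s ∧ s ≠ 0 ∧ p * s = s ∧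
      (τ s).re ≤ (τ p).re * (1 / 2) ^ k := by
    intro k
    induction k with
    | zero => exact ⟨p, hp, hpp, hp0, hpp.sq, by simp⟩
    | succ k ih =>
      obtain ⟨s, hs, hsp, hs0, hps, hle⟩ := ih
      obtain ⟨r, hr, hrp, hr0, hsr, hle2⟩ := halve hτ hs hsp hs0 (hd s hs hsp hs0)
      refine ⟨r, hr, hrp, hr0, by rw [← hsr, ← mul_assoc, hps], ?_⟩
      rw [pow_succ]
      linarith
  have hlim : Tendsto (fun k : ℕ => (τ p).re * (1 / 2 : ℝ) ^ k) atTop (nhds 0) := by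
    simpa using (tendsto_pow_atTop_nhds_zero_of_lt_one (r := (1/2 : ℝ)) (by norm_num)
      (by norm_num)).const_mul (τ p).re
  obtain ⟨k, hk⟩ := ((hlim.eventually (gt_mem_nhds hε))).exists
  obtain ⟨s, hs, hsp, hs0, hps, hle⟩ := key k
  exact ⟨s, hs, hsp, hs0, hps, lt_of_le_of_lt hle hk⟩

/-- exact trace -/
theorem exact_proj {M1 : VonNeumannAlgebra H} (hτ : IsTracialState (M1 : Set (Op H)) τ)
    (hd : ∀ p ∈ M1, IsProjection p → p ≠ 0 → ∃ x ∈ M1, ∀ t : ℂ, p * x * p ≠ t • p)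
    (hnormal : ∀ (p : ℕ → Op H) (P : Op H) (t : ℝ), (∀ k, p k ∈ M1) → (∀ k, IsProjection (p k)) →
      P ∈ M1 → IsProjection P → (∀ v, Tendsto (fun k => p k v) atTop (nhds (P v))) →
      (∀ k, P * p k = p k) → (∀ k m, k ≤ m → p m * p k = p k) →
      (∀ k, (τ (p k)).re ≤ t) → (τ P).re ≤ t)
    (t : ℝ) (ht0 : 0 ≤ t) (ht1 : t ≤ 1) :
    ∃ q ∈ M1, IsProjection q ∧ (τ q).re = t := by
  let α := {q : Op H // q ∈ M1 ∧ IsProjection q ∧ (τ q).re ≤ t}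
  obtain ⟨⟨q, hq, hqp, hqt⟩, -, hmax⟩ := bb (α := α) (fun a b => b.1 * a.1 = a.1)
    (fun a => a.2.2.1.sq) (fun a b c h1 h2 => by rw [← h1, ← mul_assoc, h2])
    (fun a => (τ a.1).re) t (fun a => a.2.2.2) (fun a b h => by
      have h' : a.1 * b.1 = a.1 := by
        have := congrArg star h
        rwa [star_mul, a.2.2.1.st, b.2.2.1.st] at this
      have hp : IsProjection (b.1 - a.1) := isProj_of (by rw [star_sub, a.2.2.1.st, b.2.2.1.st])
        (by rw [sub_mul, mul_sub, mul_sub, a.2.2.1.sq, b.2.2.1.sq, h, h']; abel)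
      have := (tr_pos hτ (sub_mem b.2.1 a.2.1) (proj_pos hp)).1
      rw [map_sub, Complex.sub_re] at this
      linarith)
    (fun s hs => by
      obtain ⟨P, hP, hlim, h1, h2⟩ := proj_lim (fun k => (s k).1) (fun k => (s k).2.2.1) hs
      have hPM := lim_mem M1 _ P (fun k => (s k).2.1) hlim
      exact ⟨⟨P, hPM, hP, hnormal _ P t (fun k => (s k).2.1) (fun k => (s k).2.2.1) hPM hP hlim
        h1 h2 (fun k => (s k).2.2.2)⟩, h1⟩)
    ⟨0, zero_mem M1, isProj_of (by simp) (by simp), by simpa using ht0⟩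
  refine ⟨q, hq, hqp, ?_⟩
  by_contra hne
  have hlt : (τ q).re < t := lt_of_le_of_ne hqt hne
  have h1q : 1 - q ≠ 0 := by
    intro h
    rw [← sub_eq_zero.1 h, hτ.map_one] at hlt
    simp at hlt
    linarith
  obtain ⟨s, hs, hsp, hs0, hqs, hslt⟩ := small_proj hτ hd (sub_mem (one_mem M1) hq) hqp.compl h1q
    (t - (τ q).re) (by linarith)
  have hqs' : q * s = 0 := by
    rw [← hqs, ← mul_assoc, mul_sub, mul_one, hqp.sq, sub_self, zero_mul]
  have hsq : s * q = 0 := by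
    have := congrArg star hqs'
    rwa [star_mul, hsp.st, hqp.st, star_zero] at this
  have hpos := tr_proj_pos hτ hs hsp hs0
  have := hmax ⟨q + s, add_mem hq hs, isProj_of (by rw [star_add, hqp.st, hsp.st])
    (by rw [add_mul, mul_add, mul_add, hqp.sq, hsp.sq, hqs', hsq]; abel), by
      rw [map_add, Complex.add_re]; linarith⟩ (by
      change (q + s) * q = q
      rw [add_mul, hqp.sq, hsq, add_zero])
  simp only [map_add, Complex.add_re] at this
  linarith

end tr

structure Core (M N M1 N1 : VonNeumannAlgebra H) (τ : Op H →ₗ[ℂ] ℂ) (E : Op H → Op H) (c : ℝ) :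
    Prop where
  hτ : IsTracialState (M : Set (Op H)) τ
  hE : IsCondExp τ (M : Set (Op H)) (N : Set (Op H)) E
  hc : 0 < c
  hb : IndexBound (M : Set (Op H)) E c
  NM : ∀ x ∈ N, x ∈ M
  M1M : ∀ x ∈ M1, x ∈ M
  N1N : ∀ x ∈ N1, x ∈ N
  N1M1 : ∀ x ∈ N1, x ∈ M1
  EM1 : ∀ x ∈ M1, E x ∈ N1
  primeM : ∀ a ∈ M, ∀ b ∈ M, (∀ x ∈ M, a * x * b = 0) → a = 0 ∨ b = 0
  primeN1 : ∀ a ∈ N1, ∀ b ∈ N1, (∀ x ∈ N1, a * x * b = 0) → a = 0 ∨ b = 0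
  opt : ∀ d, 0 < d → IndexBound (M : Set (Op H)) E d → c ≤ d
  gen : ∀ x ∈ M, ∃ (ι : Type) (_ : Fintype ι) (u y : ι → Op H),
    (∀ i, u i ∈ N ∧ y i ∈ M1 ∧ ∀ m ∈ M1, u i * m = m * u i) ∧ x = ∑ i, u i * y i

section core
variable {M N M1 N1 : VonNeumannAlgebra H} {τ : Op H →ₗ[ℂ] ℂ} {E : Op H → Op H} {c : ℝ}

theorem E_left (hE : IsCondExp τ (M : Set (Op H)) (N : Set (Op H)) E) {a x : Op H}
    (ha : a ∈ N) (hx : x ∈ M) : E (a * x) = a * E x := by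
  have := hE.bimod a ha x hx 1 (one_mem N)
  simpa using this

theorem E_right (hE : IsCondExp τ (M : Set (Op H)) (N : Set (Op H)) E) {a x : Op H}
    (ha : a ∈ N) (hx : x ∈ M) : E (x * a) = E x * a := by
  have := hE.bimod 1 (one_mem N) x hx a ha
  simpa using this

theorem E_zero (hE : IsCondExp τ (M : Set (Op H)) (N : Set (Op H)) E) : E 0 = 0 :=
  hE.fix 0 (zero_mem N)

theorem E_sub (hE : IsCondExp τ (M : Set (Op H)) (N : Set (Op H)) E) {x y : Op H}
    (hx : x ∈ M) (hy : y ∈ M) : E (x - y) = E x - E y := by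
  have h1 := hE.map_smul (-1) y hy
  have h2 := hE.map_add x hx ((-1 : ℂ) • y) (smul_mem' M _ hy)
  rw [h1] at h2
  simpa [sub_eq_add_neg] using h2

theorem E_sum (hE : IsCondExp τ (M : Set (Op H)) (N : Set (Op H)) E) {ι : Type} (s : Finset ι)
    (f : ι → Op H) (hf : ∀ i, f i ∈ M) : E (∑ i ∈ s, f i) = ∑ i ∈ s, E (f i) := by
  classical
  induction s using Finset.induction_on with
  | empty => simpa using E_zero hE
  | insert a s ha ih =>
    rw [Finset.sum_insert ha, Finset.sum_insert ha, hE.map_add _ (hf a) _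
      (sum_mem fun i _ => hf i), ih]

theorem E_pos (hc : 0 < c) (hb : IndexBound (M : Set (Op H)) E c) {x : Op H} (hx : x ∈ M)
    (hp : x.IsPositive) : (E x).IsPositive := by
  have h := (hb x hx hp).add hp
  rw [sub_add_cancel] at h
  have h1 : 0 ≤ c • E x := (ContinuousLinearMap.nonneg_iff_isPositive _).2 h
  have h2 : 0 ≤ c⁻¹ • (c • E x) := smul_nonneg (by positivity) h1
  rw [smul_smul, inv_mul_cancel₀ hc.ne', one_smul] at h2
  exact (ContinuousLinearMap.nonneg_iff_isPositive _).1 h2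

theorem E_star (hE : IsCondExp τ (M : Set (Op H)) (N : Set (Op H)) E) (hc : 0 < c)
    (hb : IndexBound (M : Set (Op H)) E c) {x : Op H} (hx : x ∈ M) :
    E (star x) = star (E x) := by
  have hsa : ∀ a ∈ M, star a = a → star (E a) = E a := by
    intro a ha hs
    have e := CFC.posPart_sub_negPart a hs
    have h1 := (E_pos hc hb (posPart_mem ha) (isPos_posPart a)).isSelfAdjoint.star_eq
    have h2 := (E_pos hc hb (negPart_mem ha) (isPos_negPart a)).isSelfAdjoint.star_eq
    have h3 := E_sub hE (posPart_mem ha) (negPart_mem ha)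
    rw [e] at h3
    rw [h3, star_sub, h1, h2]
  have k1 := hsa (x + star x) (add_mem hx (star_mem hx)) (by simp [add_comm])
  have k2 := hsa (Complex.I • (x - star x)) (smul_mem' M _ (sub_mem hx (star_mem hx))) (by
    rw [star_smul, star_sub, star_star]
    simp [smul_sub]
    abel)
  rw [hE.map_add x hx _ (star_mem hx), star_add] at k1
  rw [hE.map_smul _ _ (sub_mem hx (star_mem hx)), E_sub hE hx (star_mem hx), star_smul,
    star_sub] at k2
  have k3 : star (E x) - star (E (star x)) = -(E x - E (star x)) := by
    have := congrArg (fun z : Op H => Complex.I • z) k2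
    simp only [smul_smul] at this
    simpa using this
  have k4 : (2 : ℂ) • star (E x) = (2 : ℂ) • E (star x) := by
    have : (2 : ℂ) • star (E x) = (star (E x) + star (E (star x))) +
      (star (E x) - star (E (star x))) := by module
    rw [this, k1, k3]
    module
  exact (smul_right_injective _ (two_ne_zero (α := ℂ)) k4).symm

theorem PP (hb : IndexBound (M : Set (Op H)) E c) {x : Op H} (hx : x ∈ M) (v : H) :
    ‖x v‖ ^ 2 ≤ c * (inner ℂ (E (star x * x) v) v).re := by
  have h := (hb _ (mul_mem (star_mem hx) hx) (isPos_star_mul x)).re_inner_nonneg_left v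
  have e : inner ℂ ((c • E (star x * x) - star x * x) v) v =
      (c : ℂ) * inner ℂ (E (star x * x) v) v - inner ℂ ((star x * x) v) v := by
    rw [ContinuousLinearMap.sub_apply, inner_sub_left, ContinuousLinearMap.smul_apply,
      ← Complex.coe_smul, inner_smul_left, Complex.conj_ofReal]
  rw [e] at h
  have h2 := inner_star_mul x v
  simp only [RCLike.re_to_complex, Complex.sub_re, Complex.re_ofReal_mul] at h
  linarith

theorem proj_inner {f : Op H} (hf : IsProjection f) (v : H) :
    (inner ℂ (f v) v).re = ‖f v‖ ^ 2 := by
  have := inner_star_mul f v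
  rwa [hf.st, hf.sq] at this

theorem E_faithful (hb : IndexBound (M : Set (Op H)) E c) {x : Op H} (hx : x ∈ M)
    (h : E (star x * x) = 0) : x = 0 := by
  ext v
  have := PP hb hx v
  rw [h] at this
  simp at this
  simpa using this

theorem PPproj (hb : IndexBound (M : Set (Op H)) E c) {x f : Op H} (hx : x ∈ M)
    (hf : IsProjection f) (h : E (star x * x) = f) (v : H) : ‖x v‖ ^ 2 ≤ c * ‖f v‖ ^ 2 := by
  have := PP hb hx v
  rwa [h, proj_inner hf] at this

theorem PPsupp (hb : IndexBound (M : Set (Op H)) E c) {x f : Op H} (hx : x ∈ M)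
    (hf : IsProjection f) (h : E (star x * x) = f) : x * f = x := by
  ext v
  have := PPproj hb hx hf h (v - f v)
  have e : f (v - f v) = 0 := by
    have := congrArg (fun z : Op H => z v) hf.sq
    have e' : f (f v) = f v := this
    rw [map_sub, e', sub_self]
  rw [e] at this
  simp at this
  have h2 : x v - x (f v) = 0 := by simpa using this
  exact (sub_eq_zero.1 h2).symm

/-- Projections that are "good" for a constant `d`. -/
theorem good_extend (C : Core M N M1 N1 τ E c) {q : Op H} (hq : q ∈ M) (hqp : IsProjection q)
    (hq0 : q ≠ 0) (d : ℝ) (hd : 0 ≤ d)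
    (h : ∀ x ∈ M, ∀ v, ‖(q * x) v‖ ^ 2 ≤ d * (inner ℂ (E (star x * q * x) v) v).re) :
    IndexBound (M : Set (Op H)) E d := by
  let α := {p : Op H // p ∈ M ∧ IsProjection p ∧
    ∀ x ∈ M, ∀ v, ‖(p * x) v‖ ^ 2 ≤ d * (inner ℂ (E (star x * p * x) v) v).re}
  have hmono : ∀ a b : Op H, a ∈ M → b ∈ M → IsProjection a → IsProjection b → b * a = a →
      IsProjection (b - a) := by
    intro a b ha hb hpa hpb h
    have h' : a * b = a := by
      have := congrArg star h
      rwa [star_mul, hpa.st, hpb.st] at this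
    exact isProj_of (by rw [star_sub, hpa.st, hpb.st])
        (by rw [sub_mul, mul_sub, mul_sub, hpa.sq, hpb.sq, h, h']; abel)
  have hle1 : ∀ a ∈ M, IsProjection a → (τ a).re ≤ 1 := by
    intro a ha hpa
    have := (tr_pos C.hτ (sub_mem (one_mem M) ha) (proj_pos hpa.compl)).1
    rw [map_sub, C.hτ.map_one, Complex.sub_re, Complex.one_re] at this
    linarith
  obtain ⟨⟨p, hp, hpp, hpg⟩, -, hmax⟩ := bb (α := α) (fun a b => b.1 * a.1 = a.1)
    (fun a => a.2.2.1.sq) (fun a b c h1 h2 => by rw [← h1, ← mul_assoc, h2])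
    (fun a => (τ a.1).re) 1 (fun a => hle1 _ a.2.1 a.2.2.1) (fun a b h => by
      have hp := hmono _ _ a.2.1 b.2.1 a.2.2.1 b.2.2.1 h
      have := (tr_pos C.hτ (sub_mem b.2.1 a.2.1) (proj_pos hp)).1
      rw [map_sub, Complex.sub_re] at this
      linarith)
    (fun s hs => by
      obtain ⟨P, hP, hlim, h1, h2⟩ := proj_lim (fun k => (s k).1) (fun k => (s k).2.2.1) hs
      have hPM := lim_mem M _ P (fun k => (s k).2.1) hlim
      refine ⟨⟨P, hPM, hP, fun x hx v => ?_⟩, h1⟩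
      have hl : Tendsto (fun k => ‖((s k).1 * x) v‖ ^ 2) atTop (nhds (‖(P * x) v‖ ^ 2)) :=
        ((hlim (x v)).norm).pow 2
      refine le_of_tendsto' hl fun k => ?_
      refine ((s k).2.2.2 x hx v).trans (mul_le_mul_of_nonneg_left ?_ hd)
      have hpk := hmono _ _ (s k).2.1 hPM (s k).2.2.1 hP (h1 k)
      have hposx : (star x * (P - (s k).1) * x).IsPositive := by
        have := isPos_star_mul ((P - (s k).1) * x)
        rw [star_mul, hpk.st, mul_assoc, ← mul_assoc (P - (s k).1), hpk.sq] at this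
        rwa [mul_assoc]
      have m1 : star x * P * x ∈ M := mul_mem (mul_mem (star_mem hx) hPM) hx
      have m2 : star x * (s k).1 * x ∈ M := mul_mem (mul_mem (star_mem hx) (s k).2.1) hx
      have h3 := E_pos C.hc C.hb (mul_mem (mul_mem (star_mem hx) (sub_mem hPM (s k).2.1)) hx) hposx
      have h4 := h3.re_inner_nonneg_left v
      rw [mul_sub, sub_mul, E_sub C.hE m1 m2, ContinuousLinearMap.sub_apply, inner_sub_left] at h4
      simp only [RCLike.re_to_complex, Complex.sub_re] at h4
      linarith)
    ⟨0, zero_mem M, isProj_of (by simp) (by simp), by simp [E_zero C.hE]⟩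
  have hp1 : 1 - p = 0 := by
    by_contra hne
    have hex : ∃ y ∈ M, q * y * (1 - p) ≠ 0 := by
      by_contra! hcon
      rcases C.primeM q hq (1 - p) (sub_mem (one_mem M) hp) hcon with h | h
      · exact hq0 h
      · exact hne h
    obtain ⟨y, hy, hyne⟩ := hex
    set z := q * y * (1 - p) with hz
    have hzM : z ∈ M := mul_mem (mul_mem hq hy) (sub_mem (one_mem M) hp)
    have hqz : q * z = z := by rw [hz, ← mul_assoc, ← mul_assoc, hqp.sq]
    have hzp : z * p = 0 := by rw [hz, mul_assoc, sub_mul, one_mul, hpp.sq, sub_self, mul_zero]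
    have hpz : p * star z = 0 := by
      have := congrArg star hzp
      rwa [star_mul, hpp.st, star_zero] at this
    obtain ⟨n, hn, s, hs, hsp, hs0, hns, hf⟩ := normalize M (mul_mem (star_mem hzM) hzM)
      (isPos_star_mul z) (fun h => hyne (star_mul_eq_zero h))
    have hps : p * s = 0 := hf p (by rw [← mul_assoc, hpz, zero_mul])
    have hsp' : s * p = 0 := by
      have := congrArg star hps
      rwa [star_mul, hsp.st, hpp.st, star_zero] at this
    set w := z * n with hw
    have hwM : w ∈ M := mul_mem hzM hn
    have hww : star w * w = s := by
      rw [hw, star_mul, ← hns]; noncomm_ring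
    have hqw : q * w = w := by rw [hw, ← mul_assoc, hqz]
    have hsum : IsProjection (p + s) := isProj_of (by rw [star_add, hpp.st, hsp.st])
      (by rw [add_mul, mul_add, mul_add, hpp.sq, hsp.sq, hps, hsp']; abel)
    have hsg : ∀ x ∈ M, ∀ v, ‖(s * x) v‖ ^ 2 ≤ d * (inner ℂ (E (star x * s * x) v) v).re := by
      intro x hx v
      have h1 := h (w * x) (mul_mem hwM hx) v
      rw [← mul_assoc q, hqw] at h1
      have e1 : star (w * x) * q * (w * x) = star x * s * x := by
        rw [star_mul, ← hww]
        calc star x * star w * q * (w * x) = star x * (star w * (q * w)) * x := by noncomm_ring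
          _ = _ := by rw [hqw]
      rw [e1] at h1
      have e2 : ‖(w * x) v‖ ^ 2 = ‖(s * x) v‖ ^ 2 := by
        have := inner_star_mul w (x v)
        rw [hww, proj_inner hsp] at this
        exact this.symm
      rwa [e2] at h1
    have hpos := tr_proj_pos C.hτ hs hsp hs0
    have := hmax ⟨p + s, add_mem hp hs, hsum, fun x hx v => by
      have e1 : ‖((p + s) * x) v‖ ^ 2 = ‖(p * x) v‖ ^ 2 + ‖(s * x) v‖ ^ 2 := by
        have a1 := proj_inner hsum (x v)
        have a2 := proj_inner hpp (x v)
        have a3 := proj_inner hsp (x v)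
        rw [ContinuousLinearMap.add_apply, inner_add_left, Complex.add_re, a2, a3] at a1
        exact a1.symm
      have m1 : star x * p * x ∈ M := mul_mem (mul_mem (star_mem hx) hp) hx
      have m2 : star x * s * x ∈ M := mul_mem (mul_mem (star_mem hx) hs) hx
      rw [e1, mul_add, add_mul, C.hE.map_add _ m1 _ m2, ContinuousLinearMap.add_apply,
        inner_add_left, Complex.add_re, mul_add]
      exact add_le_add (hpg x hx v) (hsg x hx v)⟩ (by
      change (p + s) * p = p
      rw [add_mul, hpp.sq, hsp', add_zero])
    simp only [map_add, Complex.add_re] at this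
    linarith
  have hp1' : p = 1 := (sub_eq_zero.1 hp1).symm
  subst hp1'
  intro a ha hap
  obtain ⟨x, hx, hxs, rfl⟩ := exists_sqrt M ha hap
  have hEp := E_pos C.hc C.hb ha hap
  have hsa : IsSelfAdjoint (d • E (star x * x) - star x * x) := by
    change star _ = _
    rw [star_sub, star_smul, hEp.isSelfAdjoint.star_eq, hap.isSelfAdjoint.star_eq]
    simp
  rw [ContinuousLinearMap.isPositive_def']
  refine ⟨hsa, fun v => ?_⟩
  have h1 := hpg x hx v
  rw [one_mul, mul_one] at h1
  have h2 := inner_star_mul x v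
  rw [ContinuousLinearMap.reApplyInnerSelf_apply]
  have e : inner ℂ ((d • E (star x * x) - star x * x) v) v =
      (d : ℂ) * inner ℂ (E (star x * x) v) v - inner ℂ ((star x * x) v) v := by
    rw [ContinuousLinearMap.sub_apply, inner_sub_left, ContinuousLinearMap.smul_apply,
      ← Complex.coe_smul, inner_smul_left, Complex.conj_ofReal]
  rw [e]
  simp only [RCLike.re_to_complex, Complex.sub_re, Complex.re_ofReal_mul]
  linarith

end core

section core2
variable {M N M1 N1 : VonNeumannAlgebra H} {τ : Op H →ₗ[ℂ] ℂ} {E : Op H → Op H} {c : ℝ}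

theorem R_f (C : Core M N M1 N1 τ E c) {ξ ξ' f f' : Op H} (hξ' : ξ' ∈ M) (hfN : f ∈ N)
    (hf : IsProjection f) (hf' : IsProjection f')
    (h : E (star ξ * ξ) = f) (h' : E (star ξ' * ξ') = f') (hR : ξ' * f = ξ) : f' * f = f := by
  have e1 : f = f * f' * f := by
    have e0 : f * (star ξ' * ξ') * f = star ξ * ξ := by
      rw [← hR, star_mul, hf.st]; noncomm_ring
    rw [← h', ← C.hE.bimod f hfN _ (mul_mem (star_mem hξ') hξ') f hfN, e0, h]
  have e2 : (1 - f') * f = 0 := by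
    apply star_mul_eq_zero
    rw [star_mul, hf'.compl.st, hf.st]
    calc f * (1 - f') * ((1 - f') * f) = f * ((1 - f') * (1 - f')) * f := by noncomm_ring
      _ = f * f - f * f' * f := by rw [hf'.compl.sq]; noncomm_ring
      _ = 0 := by rw [← e1, hf.sq, sub_self]
  rw [sub_mul, one_mul, sub_eq_zero] at e2
  exact e2.symm

theorem R_ub (C : Core M N M1 N1 τ E c) {q : Op H} (ξ : ℕ → Op H) (hξ : ∀ k, ξ k ∈ M1)
    (hq : ∀ k, q * ξ k = ξ k) (hp : ∀ k, IsProjection (E (star (ξ k) * ξ k)))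
    (hR : ∀ k, ξ (k + 1) * E (star (ξ k) * ξ k) = ξ k) :
    ∃ z ∈ M1, q * z = z ∧ IsProjection (E (star z * z)) ∧
      ∀ k, z * E (star (ξ k) * ξ k) = ξ k := by
  set f : ℕ → Op H := fun k => E (star (ξ k) * ξ k) with hfdef
  have hξM : ∀ k, ξ k ∈ M := fun k => C.M1M _ (hξ k)
  have hfN1 : ∀ k, f k ∈ N1 := fun k => C.EM1 _ (mul_mem (star_mem (hξ k)) (hξ k))
  have hfN : ∀ k, f k ∈ N := fun k => C.N1N _ (hfN1 k)
  have hff : ∀ k, f (k + 1) * f k = f k := fun k =>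
    R_f C (hξM _) (hfN k) (hp k) (hp (k + 1)) rfl rfl (hR k)
  obtain ⟨F, hF, hlim, hF1, hmono⟩ := proj_lim f hp hff
  have hFN1 : F ∈ N1 := lim_mem N1 f F hfN1 hlim
  have hFN : F ∈ N := C.N1N _ hFN1
  have hsupp : ∀ k, ξ k * f k = ξ k := fun k => PPsupp C.hb (hξM k) (hp k) rfl
  have hle : ∀ k m, k ≤ m → ξ m * f k = ξ k := by
    intro k m hkm
    induction m, hkm using Nat.le_induction with
    | base => exact hsupp k
    | succ m hm ih => rw [← hmono k m hm, ← mul_assoc, hR m, ih]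
  have hest0 : ∀ v k m, k ≤ m → ‖ξ m v - ξ k v‖ ≤ Real.sqrt c * ‖f m v - f k v‖ := by
    intro v k m hkm
    have h1 := PPproj C.hb (hξM m) (hp m) rfl (f m v - f k v)
    have e1 : ξ m (f m v - f k v) = ξ m v - ξ k v := by
      rw [map_sub]
      have a1 : ξ m (f m v) = ξ m v := congrArg (fun z : Op H => z v) (hsupp m)
      have a2 : ξ m (f k v) = ξ k v := congrArg (fun z : Op H => z v) (hle k m hkm)
      rw [a1, a2]
    have e2 : E (star (ξ m) * ξ m) (f m v - f k v) = f m v - f k v := by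
      rw [map_sub]
      have a1 : f m (f m v) = f m v := congrArg (fun z : Op H => z v) (hp m).sq
      have a2 : f m (f k v) = f k v := congrArg (fun z : Op H => z v) (hmono k m hkm)
      change f m (f m v) - f m (f k v) = _
      rw [a1, a2]
    rw [e1, e2] at h1
    rw [← Real.sqrt_sq (norm_nonneg (ξ m v - ξ k v)), ← Real.sqrt_sq (norm_nonneg (f m v - f k v)),
      ← Real.sqrt_mul C.hc.le]
    exact Real.sqrt_le_sqrt h1
  have hest : ∀ v k m, ‖ξ m v - ξ k v‖ ≤ Real.sqrt c * ‖f m v - f k v‖ := by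
    intro v k m
    rcases le_total k m with h | h
    · exact hest0 v k m h
    · rw [norm_sub_rev, norm_sub_rev (f m v)]; exact hest0 v m k h
  have hc0 : 0 < Real.sqrt c := Real.sqrt_pos.2 C.hc
  obtain ⟨z, hz⟩ := op_lim ξ (fun v => by
    rw [Metric.cauchySeq_iff]
    intro ε hε
    obtain ⟨K, hK⟩ := Metric.cauchySeq_iff.1 (hlim v).cauchySeq (ε / Real.sqrt c) (by positivity)
    refine ⟨K, fun m hm k hk => ?_⟩
    have := hK m hm k hk
    rw [dist_eq_norm] at this ⊢
    refine (hest v k m).trans_lt ?_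
    rw [lt_div_iff₀ hc0] at this
    linarith)
  have hzM1 : z ∈ M1 := lim_mem M1 ξ z hξ hz
  have hzM := C.M1M _ hzM1
  have hzf : ∀ k, z * f k = ξ k := by
    intro k
    ext v
    refine tendsto_nhds_unique (hz (f k v)) (tendsto_const_nhds.congr' ?_)
    filter_upwards [eventually_ge_atTop k] with m hm
    exact (congrArg (fun z : Op H => z v) (hle k m hm)).symm
  have hqz : q * z = z := by
    ext v
    refine tendsto_nhds_unique ((q.continuous.tendsto _).comp (hz v)) ((hz v).congr fun k => ?_)
    exact (congrArg (fun z : Op H => z v) (hq k)).symm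
  have hnorm : ∀ v, ‖z v‖ ^ 2 ≤ c * ‖F v‖ ^ 2 := fun v =>
    le_of_tendsto_of_tendsto' ((hz v).norm.pow 2) (((hlim v).norm.pow 2).const_mul c)
      (fun k => PPproj C.hb (hξM k) (hp k) rfl v)
  have hzF : z * F = z := by
    ext v
    have h1 := hnorm (v - F v)
    have e : F (v - F v) = 0 := by
      have e' : F (F v) = F v := congrArg (fun z : Op H => z v) hF.sq
      rw [map_sub, e', sub_self]
    rw [e] at h1
    simp at h1
    have h2 : z v - z (F v) = 0 := by simpa using h1
    exact (sub_eq_zero.1 h2).symm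
  have hzz : star z * z ∈ M := mul_mem (star_mem hzM) hzM
  set B := E (star z * z) with hB
  have hfB : ∀ k, f k * B * f k = f k := by
    intro k
    rw [hB, ← C.hE.bimod _ (hfN k) _ hzz _ (hfN k)]
    have : f k * (star z * z) * f k = star (ξ k) * ξ k := by
      rw [← hzf k, star_mul, (hp k).st]; noncomm_ring
    rw [this]
  have hFB : F * B * F = B := by
    rw [hB, ← C.hE.bimod _ hFN _ hzz _ hFN]
    have : F * (star z * z) * F = star z * z := by
      calc F * (star z * z) * F = (star F * star z) * (z * F) := by rw [hF.st]; noncomm_ring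
        _ = _ := by rw [← star_mul, hzF]
    rw [this]
  have hinn : ∀ (g : Op H), IsProjection g → ∀ v w, inner ℂ (g v) w = inner ℂ v (g w) := by
    intro g hg v w
    have := star_inner g v w
    rwa [hg.st] at this
  have hFBF : F * B * F = F := by
    ext v
    refine ext_inner_right ℂ fun w => ?_
    change inner ℂ (F (B (F v))) w = _
    rw [hinn F hF]
    have t1 : Tendsto (fun k => inner ℂ (B (f k v)) (f k w)) atTop (nhds (inner ℂ (B (F v)) (F w))) :=
      Tendsto.inner ((B.continuous.tendsto _).comp (hlim v)) (hlim w)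
    have t2 : Tendsto (fun k => inner ℂ (f k v) w) atTop (nhds (inner ℂ (F v) w)) :=
      Tendsto.inner (hlim v) tendsto_const_nhds
    refine tendsto_nhds_unique t1 (t2.congr fun k => ?_)
    rw [← hinn (f k) (hp k)]
    have : f k (B (f k v)) = f k v := congrArg (fun z : Op H => z v) (hfB k)
    rw [this]
  exact ⟨z, hzM1, hqz, by rw [← hB, ← hFB, hFBF]; exact hF, hzf⟩

theorem core_max (C : Core M N M1 N1 τ E c) (q : Op H) :
    ∃ ξ ∈ M1, q * ξ = ξ ∧ IsProjection (E (star ξ * ξ)) ∧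
      ∀ ξ' ∈ M1, q * ξ' = ξ' → IsProjection (E (star ξ' * ξ')) → ξ' * E (star ξ * ξ) = ξ →
        (τ (E (star ξ' * ξ'))).re ≤ (τ (E (star ξ * ξ))).re := by
  let α := {ξ : Op H // ξ ∈ M1 ∧ q * ξ = ξ ∧ IsProjection (E (star ξ * ξ))}
  have hN : ∀ a : α, E (star a.1 * a.1) ∈ N := fun a =>
    C.N1N _ (C.EM1 _ (mul_mem (star_mem a.2.1) a.2.1))
  have hff : ∀ a b : α, b.1 * E (star a.1 * a.1) = a.1 →
      E (star b.1 * b.1) * E (star a.1 * a.1) = E (star a.1 * a.1) := fun a b h =>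
    R_f C (C.M1M _ b.2.1) (hN a) a.2.2.2 b.2.2.2 rfl rfl h
  obtain ⟨⟨ξ, h1, h2, h3⟩, -, hmax⟩ := bb (α := α) (fun a b => b.1 * E (star a.1 * a.1) = a.1)
    (fun a => PPsupp C.hb (C.M1M _ a.2.1) a.2.2.2 rfl)
    (fun a b d h1 h2 => by
      change d.1 * _ = _
      rw [← hff a b h1, ← mul_assoc, h2, h1])
    (fun a => (τ (E (star a.1 * a.1))).re) 1
    (fun a => by
      have := (tr_pos C.hτ (sub_mem (one_mem M) (C.NM _ (hN a))) (proj_pos a.2.2.2.compl)).1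
      rw [map_sub, C.hτ.map_one, Complex.sub_re, Complex.one_re] at this
      linarith)
    (fun a b h => by
      have h1 := hff a b h
      have h1' := congrArg star h1
      rw [star_mul, a.2.2.2.st, b.2.2.2.st] at h1'
      have hp : IsProjection (E (star b.1 * b.1) - E (star a.1 * a.1)) :=
        isProj_of (by rw [star_sub, a.2.2.2.st, b.2.2.2.st])
          (by rw [sub_mul, mul_sub, mul_sub, a.2.2.2.sq, b.2.2.2.sq, h1, h1']; abel)
      have := (tr_pos C.hτ (sub_mem (C.NM _ (hN b)) (C.NM _ (hN a))) (proj_pos hp)).1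
      rw [map_sub, Complex.sub_re] at this
      linarith)
    (fun s hs => by
      obtain ⟨z, a1, a2, a3, a4⟩ := R_ub C (q := q) (fun k => (s k).1) (fun k => (s k).2.1)
        (fun k => (s k).2.2.1) (fun k => (s k).2.2.2) hs
      exact ⟨⟨z, a1, a2, a3⟩, a4⟩)
    ⟨0, zero_mem M1, mul_zero _, by
      rw [mul_zero, E_zero C.hE]; exact isProj_of (by simp) (by simp)⟩
  exact ⟨ξ, h1, h2, h3, fun ξ' a1 a2 a3 a4 => hmax ⟨ξ', a1, a2, a3⟩ a4⟩

end core2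

section core3
variable {M N M1 N1 : VonNeumannAlgebra H} {τ : Op H →ₗ[ℂ] ℂ} {E : Op H → Op H} {c : ℝ}

theorem core_absorb (C : Core M N M1 N1 τ E c) {q ξ : Op H} (hξ : ξ ∈ M1) (hqξ : q * ξ = ξ)
    (hp : IsProjection (E (star ξ * ξ)))
    (hmax : ∀ ξ' ∈ M1, q * ξ' = ξ' → IsProjection (E (star ξ' * ξ')) →
      ξ' * E (star ξ * ξ) = ξ → (τ (E (star ξ' * ξ'))).re ≤ (τ (E (star ξ * ξ))).re)
    (hne : E (star ξ * ξ) ≠ 1) {η : Op H} (hη : η ∈ M1) (hqη : q * η = η) :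
    η = ξ * E (star ξ * η) := by
  by_contra hcon
  set f := E (star ξ * ξ) with hf
  have hξM := C.M1M _ hξ
  have hfN1 : f ∈ N1 := C.EM1 _ (mul_mem (star_mem hξ) hξ)
  have hfN := C.N1N _ hfN1
  have hξf : ξ * f = ξ := PPsupp C.hb hξM hp rfl
  have ha : E (star ξ * η) ∈ N1 := C.EM1 _ (mul_mem (star_mem hξ) hη)
  have hfa : f * E (star ξ * η) = E (star ξ * η) := by
    rw [← E_left C.hE hfN (mul_mem (star_mem hξM) (C.M1M _ hη)), ← mul_assoc]
    have : f * star ξ = star ξ := by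
      have := congrArg star hξf
      rwa [star_mul, hp.st] at this
    rw [this]
  set η0 := η - ξ * E (star ξ * η) with hη0
  have hη0M1 : η0 ∈ M1 := sub_mem hη (mul_mem hξ (C.N1M1 _ ha))
  have hη0ne : η0 ≠ 0 := fun h => hcon (sub_eq_zero.1 h)
  have hqη0 : q * η0 = η0 := by rw [hη0, mul_sub, hqη, ← mul_assoc, hqξ]
  have horth : E (star ξ * η0) = 0 := by
    rw [hη0, mul_sub, E_sub C.hE (mul_mem (star_mem hξM) (C.M1M _ hη))
      (mul_mem (star_mem hξM) (mul_mem hξM (C.M1M _ (C.N1M1 _ ha)))), ← mul_assoc,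
      E_right C.hE (C.N1N _ ha) (mul_mem (star_mem hξM) hξM), ← hf, hfa, sub_self]
  have hη0M := C.M1M _ hη0M1
  set b := E (star η0 * η0) with hb
  have hbN1 : b ∈ N1 := C.EM1 _ (mul_mem (star_mem hη0M1) hη0M1)
  have hb0 : b ≠ 0 := fun h => hη0ne (E_faithful C.hb hη0M h)
  have hex : ∃ y ∈ N1, b * y * (1 - f) ≠ 0 := by
    by_contra! hc
    rcases C.primeN1 b hbN1 (1 - f) (sub_mem (one_mem N1) hfN1) hc with h | h
    · exact hb0 h
    · exact hne (sub_eq_zero.1 h).symm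
  obtain ⟨y, hy, hyne⟩ := hex
  have hgN1 : y * (1 - f) ∈ N1 := mul_mem hy (sub_mem (one_mem N1) hfN1)
  set η1 := η0 * (y * (1 - f)) with hη1
  have hη1M1 : η1 ∈ M1 := mul_mem hη0M1 (C.N1M1 _ hgN1)
  have hη1M := C.M1M _ hη1M1
  have hη1ne : η1 ≠ 0 := by
    intro h
    apply hyne
    rw [mul_assoc, hb, ← E_right C.hE (C.N1N _ hgN1) (mul_mem (star_mem hη0M) hη0M), mul_assoc,
      ← hη1, h, mul_zero, E_zero C.hE]
  have hη1f : η1 * f = 0 := by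
    have : (1 - f) * f = 0 := by rw [sub_mul, one_mul, hp.sq, sub_self]
    rw [hη1, mul_assoc, mul_assoc, this, mul_zero, mul_zero]
  have hqη1 : q * η1 = η1 := by rw [hη1, ← mul_assoc, hqη0]
  have horth1 : E (star ξ * η1) = 0 := by
    rw [hη1, ← mul_assoc, E_right C.hE (C.N1N _ hgN1) (mul_mem (star_mem hξM) hη0M), horth, zero_mul]
  have hη1η1 : star η1 * η1 ∈ M := mul_mem (star_mem hη1M) hη1M
  set b1 := E (star η1 * η1) with hb1
  have hb1N1 : b1 ∈ N1 := C.EM1 _ (mul_mem (star_mem hη1M1) hη1M1)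
  have hb1ne : b1 ≠ 0 := fun h => hη1ne (E_faithful C.hb hη1M h)
  have hb1pos : b1.IsPositive := E_pos C.hc C.hb hη1η1 (isPos_star_mul η1)
  obtain ⟨n, hn, s, hs, hsp, hs0, hns, hfs⟩ := PopaQ.normalize N1 hb1N1 hb1pos hb1ne
  have hfb1 : f * b1 = 0 := by
    rw [hb1, ← E_left C.hE hfN hη1η1, ← mul_assoc]
    have : f * star η1 = 0 := by
      have := congrArg star hη1f
      rwa [star_mul, hp.st, star_zero] at this
    rw [this, zero_mul, E_zero C.hE]
  have hfs0 : f * s = 0 := hfs f hfb1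
  have hsf0 : s * f = 0 := by
    have := congrArg star hfs0
    rwa [star_mul, hsp.st, hp.st, star_zero] at this
  set η2 := η1 * n with hη2
  have hnM1 := C.N1M1 _ hn
  have hη2M1 : η2 ∈ M1 := mul_mem hη1M1 hnM1
  have hη2M := C.M1M _ hη2M1
  have hE22 : E (star η2 * η2) = s := by
    have : star η2 * η2 = star n * (star η1 * η1) * n := by
      rw [hη2, star_mul]; noncomm_ring
    rw [this, C.hE.bimod _ (star_mem (C.N1N _ hn)) _ hη1η1 _ (C.N1N _ hn), ← hb1, hns]
  have hE12 : E (star ξ * η2) = 0 := by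
    rw [hη2, ← mul_assoc, E_right C.hE (C.N1N _ hn) (mul_mem (star_mem hξM) hη1M), horth1, zero_mul]
  have hE21 : E (star η2 * ξ) = 0 := by
    have : star η2 * ξ = star (star ξ * η2) := by rw [star_mul (star ξ), star_star]
    rw [this, E_star C.hE C.hc C.hb (mul_mem (star_mem hξM) hη2M), hE12, star_zero]
  have hη2s : η2 * s = η2 := PPsupp C.hb hη2M hsp hE22
  have hη2f : η2 * f = 0 := by rw [← hη2s, mul_assoc, hsf0, mul_zero]
  have hEsum : E (star (ξ + η2) * (ξ + η2)) = f + s := by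
    have m1 : star ξ * ξ ∈ M := mul_mem (star_mem hξM) hξM
    have m2 : star ξ * η2 ∈ M := mul_mem (star_mem hξM) hη2M
    have m3 : star η2 * ξ ∈ M := mul_mem (star_mem hη2M) hξM
    have m4 : star η2 * η2 ∈ M := mul_mem (star_mem hη2M) hη2M
    have : star (ξ + η2) * (ξ + η2) =
        (star ξ * ξ + star ξ * η2) + (star η2 * ξ + star η2 * η2) := by
      rw [star_add]; noncomm_ring
    rw [this, C.hE.map_add _ (add_mem m1 m2) _ (add_mem m3 m4), C.hE.map_add _ m1 _ m2,
      C.hE.map_add _ m3 _ m4, hE12, hE21, hE22, add_zero, zero_add]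
  have := hmax (ξ + η2) (add_mem hξ hη2M1) (by rw [mul_add, hqξ, hη2, ← mul_assoc, hqη1])
    (by
      rw [hEsum]
      exact isProj_of (by rw [star_add, hp.st, hsp.st])
        (by rw [add_mul, mul_add, mul_add, hp.sq, hsp.sq, hfs0, hsf0]; abel))
    (by rw [add_mul, hξf, hη2f, add_zero])
  rw [hEsum, map_add, Complex.add_re] at this
  have h0 := tr_proj_pos C.hτ (C.NM _ (C.N1N _ hs)) hsp hs0
  linarith

theorem core_exists (C : Core M N M1 N1 τ E c) {q : Op H} (hq : q ∈ M1) (hqp : IsProjection q)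
    (hqt : c * (τ q).re = 1) :
    ∃ e ∈ M1, IsProjection e ∧ E e = ((c⁻¹ : ℝ) : ℂ) • (1 : Op H) := by
  have hc := C.hc
  have hqM := C.M1M _ hq
  have hq0 : q ≠ 0 := by
    rintro rfl
    simp at hqt
  obtain ⟨ξ, hξ, hqξ, hp, hmax⟩ := core_max C q
  have hξM := C.M1M _ hξ
  have hξξ : star ξ * ξ ∈ M := mul_mem (star_mem hξM) hξM
  have hξξ' : ξ * star ξ ∈ M := mul_mem hξM (star_mem hξM)
  have hξq : star ξ * q = star ξ := by
    have := congrArg star hqξ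
    rwa [star_mul, hqp.st] at this
  have htr : τ (ξ * star ξ) = τ (E (star ξ * ξ)) := by
    rw [C.hE.tr _ hξξ, C.hτ.tracial _ hξM _ (star_mem hξM)]
  have hqr := tr_real C.hτ hqM (proj_pos hqp)
  by_cases hf1 : E (star ξ * ξ) = 1
  · have hnorm : ∀ v, ‖ξ v‖ ^ 2 ≤ c * ‖v‖ ^ 2 := by
      intro v
      have := PPproj C.hb hξM hp rfl v
      rwa [hf1] at this
    -- `ξ ξ* ≤ c`
    have hnorm' : ∀ v, ‖star ξ v‖ ^ 2 ≤ c * ‖v‖ ^ 2 := by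
      intro v
      have hle : ‖ξ‖ ≤ Real.sqrt c := by
        refine ContinuousLinearMap.opNorm_le_bound _ (Real.sqrt_nonneg _) fun v => ?_
        rw [← Real.sqrt_sq (norm_nonneg (ξ v)), ← Real.sqrt_sq (norm_nonneg v),
          ← Real.sqrt_mul hc.le]
        exact Real.sqrt_le_sqrt (hnorm v)
      have h1 : ‖star ξ v‖ ≤ Real.sqrt c * ‖v‖ := by
        refine ((star ξ).le_opNorm v).trans ?_
        rw [norm_star]
        gcongr
      calc ‖star ξ v‖ ^ 2 ≤ (Real.sqrt c * ‖v‖) ^ 2 := by gcongr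
        _ = _ := by rw [mul_pow, Real.sq_sqrt hc.le]
    have hpos : ((c : ℂ) • q - ξ * star ξ).IsPositive := by
      rw [ContinuousLinearMap.isPositive_def']
      refine ⟨?_, fun v => ?_⟩
      · change star _ = _
        rw [star_sub, star_smul, hqp.st, star_mul, star_star]
        simp
      · rw [ContinuousLinearMap.reApplyInnerSelf_apply, ContinuousLinearMap.sub_apply,
          inner_sub_left, ContinuousLinearMap.smul_apply, inner_smul_left, Complex.conj_ofReal]
        simp only [RCLike.re_to_complex, Complex.sub_re, Complex.re_ofReal_mul]
        rw [proj_inner hqp]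
        have h1 := inner_star_mul (star ξ) v
        rw [star_star] at h1
        rw [h1]
        have h2 := hnorm' (q v)
        have e : star ξ (q v) = star ξ v := congrArg (fun z : Op H => z v) hξq
        rw [e] at h2
        linarith
    have hz := tr_pos_zero C.hτ (sub_mem (smul_mem' M _ hqM) hξξ') hpos (by
      rw [map_sub, map_smul, htr, hf1, C.hτ.map_one, hqr]
      simp
      linarith)
    have hz' : ξ * star ξ = (c : ℂ) • q := (sub_eq_zero.1 hz).symm
    refine ⟨((c⁻¹ : ℝ) : ℂ) • (star ξ * ξ), smul_mem' M1 _ (mul_mem (star_mem hξ) hξ), ?_, ?_⟩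
    · refine isProj_of ?_ ?_
      · rw [star_smul, star_mul, star_star]; simp
      · have : star ξ * ξ * (star ξ * ξ) = (c : ℂ) • (star ξ * ξ) := by
          calc star ξ * ξ * (star ξ * ξ) = star ξ * (ξ * star ξ) * ξ := by noncomm_ring
            _ = _ := by rw [hz', mul_smul_comm, smul_mul_assoc, hξq]
        rw [smul_mul_assoc, mul_smul_comm, this, smul_smul, smul_smul]
        congr 1
        push_cast
        have : (c : ℂ) ≠ 0 := by exact_mod_cast hc.ne'
        field_simp
    · rw [C.hE.map_smul _ _ hξξ, hf1]
  · exfalso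
    set f := E (star ξ * ξ) with hf
    have hfN : f ∈ N := C.hE.mem _ hξξ
    have hξf : ξ * f = ξ := PPsupp C.hb hξM hp rfl
    have hfξ : f * star ξ = star ξ := by
      have := congrArg star hξf
      rwa [star_mul, hp.st] at this
    have hfa : ∀ x ∈ M, f * E (star ξ * x) = E (star ξ * x) := by
      intro x hx
      rw [← E_left C.hE hfN (mul_mem (star_mem hξM) hx), ← mul_assoc, hfξ]
    have hall : ∀ x ∈ M, q * x = ξ * E (star ξ * x) := by
      intro x hx
      obtain ⟨ι, _, u, y, huy, rfl⟩ := C.gen x hx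
      have huyM : ∀ i, u i * y i ∈ M := fun i => mul_mem (C.NM _ (huy i).1) (C.M1M _ (huy i).2.1)
      rw [Finset.mul_sum, Finset.mul_sum, E_sum C.hE _ _ (fun i => mul_mem (star_mem hξM) (huyM i)),
        Finset.mul_sum]
      refine Finset.sum_congr rfl fun i _ => ?_
      obtain ⟨hu, hy, hcom⟩ := huy i
      have hqy : q * y i ∈ M1 := mul_mem hq hy
      have h1 := core_absorb C hξ hqξ hp hmax hf1 hqy (by rw [← mul_assoc, hqp.sq])
      have e1 : star ξ * (q * y i) = star ξ * y i := by rw [← mul_assoc, hξq]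
      rw [e1] at h1
      calc q * (u i * y i) = u i * (q * y i) := by rw [← mul_assoc, ← hcom q hq, mul_assoc]
        _ = u i * (ξ * E (star ξ * y i)) := by rw [← h1]
        _ = ξ * (u i * E (star ξ * y i)) := by rw [← mul_assoc, hcom ξ hξ, mul_assoc]
        _ = ξ * E (u i * (star ξ * y i)) := by
            rw [E_left C.hE hu (mul_mem (star_mem hξM) (C.M1M _ hy))]
        _ = ξ * E (star ξ * (u i * y i)) := by
            rw [← mul_assoc, hcom _ (star_mem hξ), mul_assoc]
    have hstarall : ∀ x ∈ M, x * q = E (x * ξ) * star ξ := by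
      intro x hx
      have h1 := congrArg star (hall _ (star_mem hx))
      rw [star_mul, star_star, hqp.st, star_mul,
        ← E_star C.hE hc C.hb (mul_mem (star_mem hξM) (star_mem hx)), star_mul, star_star,
        star_star] at h1
      exact h1
    have hz := corner_scalar C.hτ C.primeM hqM hqp hξξ' (by
        change star _ = _
        rw [star_mul, star_star]) (by rw [← mul_assoc, hqξ]) (fun x hx => by
        have h1 := hall (x * ξ) (mul_mem hx hξM)
        have h2 := hstarall (star ξ * x) (mul_mem (star_mem hξM) hx)
        calc q * x * (ξ * star ξ) = (q * (x * ξ)) * star ξ := by noncomm_ring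
          _ = ξ * (E (star ξ * (x * ξ)) * star ξ) := by rw [h1, mul_assoc]
          _ = ξ * (star ξ * x * q) := by rw [h2, ← mul_assoc (star ξ)]
          _ = _ := by noncomm_ring) (c * (τ f).re) (by
        rw [htr, hqr, tr_real C.hτ (C.NM _ hfN) (proj_pos hp)]
        rw [← Complex.ofReal_mul]
        simp only [Complex.ofReal_re]
        congr 1
        calc (τ f).re = (τ f).re * (c * (τ q).re) := by rw [hqt, mul_one]
          _ = _ := by ring)
    have hf1' : (τ f).re < 1 := by
      have hne : (1 : Op H) - f ≠ 0 := fun h => hf1 (sub_eq_zero.1 h).symm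
      have := tr_proj_pos C.hτ (sub_mem (one_mem M) (C.NM _ hfN)) hp.compl hne
      rw [map_sub, C.hτ.map_one, Complex.sub_re, Complex.one_re] at this
      linarith
    have hf0 : 0 ≤ (τ f).re := (tr_pos C.hτ (C.NM _ hfN) (proj_pos hp)).1
    set d := c * (τ f).re with hd
    have hd0 : 0 ≤ d := by positivity
    have hdc : d < c := by
      calc d < c * 1 := by rw [hd]; gcongr
        _ = c := mul_one c
    -- norm bound
    have hnormξ : ‖ξ‖ ^ 2 ≤ d := by
      have h1 : ‖ξ‖ * ‖ξ‖ = ‖ξ * star ξ‖ := (CStarRing.norm_self_mul_star).symm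
      have hq1 : ‖q‖ ≤ 1 := by
        refine ContinuousLinearMap.opNorm_le_bound _ zero_le_one fun v => ?_
        have := proj_inner hqp v
        have h2 : (inner ℂ (q v) v).re ≤ ‖q v‖ * ‖v‖ := re_inner_le_norm (𝕜 := ℂ) (q v) v
        rcases (norm_nonneg (q v)).eq_or_lt with h0 | h0
        · rw [← h0]; positivity
        · nlinarith
      rw [sq, h1, hz, norm_smul, Complex.norm_real, Real.norm_of_nonneg hd0]
      nlinarith [norm_nonneg q]
    set d' := max d (c / 2) with hd'
    have hd'0 : 0 < d' := lt_max_of_lt_right (by positivity)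
    have hd'c : d' < c := max_lt hdc (by linarith)
    have hgood := good_extend C hqM hqp hq0 d' hd'0.le (fun x hx v => by
      set a := E (star ξ * x) with ha
      have haN : a ∈ N := C.hE.mem _ (mul_mem (star_mem hξM) hx)
      have hqx : q * x = ξ * a := hall x hx
      have e1 : star x * q * x = star a * (star ξ * ξ) * a := by
        calc star x * q * x = star (q * x) * (q * x) := by
              rw [star_mul, hqp.st]
              calc star x * q * x = star x * (q * q) * x := by rw [hqp.sq]
                _ = _ := by noncomm_ring
          _ = _ := by rw [hqx, star_mul]; noncomm_ring
      have e2 : E (star x * q * x) = star a * a := by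
        rw [e1, C.hE.bimod _ (star_mem haN) _ hξξ _ haN, ← hf, mul_assoc, hfa x hx]
      rw [hqx, e2, inner_star_mul]
      have h1 : ‖ξ (a v)‖ ≤ ‖ξ‖ * ‖a v‖ := ξ.le_opNorm _
      have h2 : ‖(ξ * a) v‖ ^ 2 ≤ ‖ξ‖ ^ 2 * ‖a v‖ ^ 2 := by
        rw [← mul_pow]
        change ‖ξ (a v)‖ ^ 2 ≤ _
        gcongr
      refine h2.trans ?_
      gcongr
      exact hnormξ.trans (le_max_left _ _))
    exact absurd (C.opt d' hd'0 hgood) (not_le.2 hd'c)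

end core3

theorem exists_relVN (M : VonNeumannAlgebra H) (A : StarSubalgebra ℂ (Op H)) :
    ∃ M1 : VonNeumannAlgebra H, ∀ x, x ∈ M1 ↔ (x ∈ M ∧ ∀ y ∈ A, y * x = x * y) := by
  set S : Set (Op H) := (A : Set (Op H)) ∪ (M.commutant : Set (Op H)) with hS
  refine ⟨{ StarSubalgebra.centralizer ℂ S with
    centralizer_centralizer' := by simp }, fun x => ?_⟩
  change x ∈ StarSubalgebra.centralizer ℂ S ↔ _
  rw [StarSubalgebra.mem_centralizer_iff]
  constructor
  · intro h
    exact ⟨mem_of_comm M fun y hy => (h y (Or.inr hy)).1, fun y hy => (h y (Or.inl hy)).1⟩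
  · rintro ⟨h1, h2⟩ y hy
    rcases hy with hy | hy
    · exact ⟨h2 y hy, h2 _ (star_mem hy)⟩
    · exact ⟨comm_of_mem M h1 hy, comm_of_mem M h1 (star_mem hy)⟩

/-- Matrix units spanning `A`. -/
structure MU (A : StarSubalgebra ℂ (Op H)) (d : ℕ) (u : Fin d → Fin d → Op H) : Prop where
  mem : ∀ i j, u i j ∈ A
  mul : ∀ i j k, u i j * u j k = u i k
  mul0 : ∀ i j k l, j ≠ k → u i j * u k l = 0
  st : ∀ i j, star (u i j) = u j i
  one : ∑ i, u i i = 1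
  span : ∀ y ∈ A, ∃ a : Fin d → Fin d → ℂ, y = ∑ i, ∑ j, a i j • u i j

theorem exists_MU (A : StarSubalgebra ℂ (Op H)) (d : ℕ)
    (φ : A ≃⋆ₐ[ℂ] Matrix (Fin d) (Fin d) ℂ) : ∃ u, MU A d u := by
  refine ⟨fun i j => ((φ.symm (Matrix.single i j 1) : A) : Op H), ?_, ?_, ?_, ?_, ?_, ?_⟩
  · intro i j; exact Subtype.coe_prop _
  · intro i j k
    rw [← MulMemClass.coe_mul, ← map_mul]
    simp
  · intro i j k l h
    rw [← MulMemClass.coe_mul, ← map_mul, Matrix.single_mul_single_of_ne _ _ _ _ h]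
    simp
  · intro i j
    rw [← StarMemClass.coe_star, ← map_star]
    congr 2
    rw [Matrix.star_eq_conjTranspose, Matrix.conjTranspose_single]
    simp
  · have h1 : (∑ i, Matrix.single i i (1 : ℂ)) = (1 : Matrix (Fin d) (Fin d) ℂ) := by
      ext a b
      rw [Matrix.sum_apply]
      simp only [Matrix.single_apply, Matrix.one_apply]
      by_cases hab : a = b
      · subst hab; simp
      · rw [if_neg hab]
        refine Finset.sum_eq_zero fun i _ => if_neg ?_
        rintro ⟨rfl, rfl⟩
        exact hab rfl
    have := congrArg (fun z => ((φ.symm z : A) : Op H)) h1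
    simpa using this
  · intro y hy
    refine ⟨fun i j => φ ⟨y, hy⟩ i j, ?_⟩
    have h1 := Matrix.matrix_eq_sum_single (φ ⟨y, hy⟩)
    have := congrArg (fun z => ((φ.symm z : A) : Op H)) h1
    simp only [StarAlgEquiv.symm_apply_apply] at this
    refine this.trans ?_
    simp only [map_sum]
    rw [AddSubmonoidClass.coe_finset_sum]
    refine Finset.sum_congr rfl fun i _ => ?_
    rw [AddSubmonoidClass.coe_finset_sum]
    refine Finset.sum_congr rfl fun j _ => ?_
    have : Matrix.single i j (φ ⟨y, hy⟩ i j) = (φ ⟨y, hy⟩ i j) • Matrix.single i j (1 : ℂ) := by simp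
    rw [this, map_smul]
    rfl

section mu
variable {A : StarSubalgebra ℂ (Op H)} {d : ℕ} {u : Fin d → Fin d → Op H}

theorem MU.avg (h : MU A d u) (x : Op H) (i j : Fin d) :
    ∀ y ∈ A, y * (∑ k, u k i * x * u j k) = (∑ k, u k i * x * u j k) * y := by
  have key : ∀ a b, u a b * (∑ k, u k i * x * u j k) = (∑ k, u k i * x * u j k) * u a b := by
    intro a b
    rw [Finset.mul_sum, Finset.sum_mul, Finset.sum_eq_single b, Finset.sum_eq_single a]
    · rw [← mul_assoc, ← mul_assoc, h.mul, mul_assoc (_ * x), h.mul]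
    · intro k _ hk
      rw [mul_assoc, h.mul0 _ _ _ _ hk, mul_zero]
    · simp
    · intro k _ hk
      rw [← mul_assoc, ← mul_assoc, h.mul0 _ _ _ _ hk.symm, zero_mul, zero_mul]
    · simp
  intro y hy
  obtain ⟨a, rfl⟩ := h.span y hy
  generalize (∑ k, u k i * x * u j k) = z at *
  simp only [Finset.sum_mul, Finset.mul_sum, smul_mul_assoc, mul_smul_comm, key]

theorem MU.expand (h : MU A d u) (x : Op H) :
    x = ∑ p : Fin d × Fin d, u p.1 p.2 * (∑ k, u k p.1 * x * u p.2 k) := by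
  have e : ∀ i j, u i j * (∑ k, u k i * x * u j k) = u i i * x * u j j := by
    intro i j
    rw [Finset.mul_sum, Finset.sum_eq_single j]
    · rw [← mul_assoc, ← mul_assoc, h.mul]
    · intro k _ hk
      rw [← mul_assoc, ← mul_assoc, h.mul0 _ _ _ _ hk.symm, zero_mul, zero_mul]
    · simp
  simp only [e]
  rw [Fintype.sum_prod_type]
  simp only [← Finset.mul_sum, ← Finset.sum_mul, h.one, one_mul, mul_one]

theorem MU.proj (h : MU A d u) (i : Fin d) : IsProjection (u i i) :=
  isProj_of (h.st i i) (h.mul i i i)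

theorem MU.trace (h : MU A d u) {M : VonNeumannAlgebra H} {τ : Op H →ₗ[ℂ] ℂ}
    (hτ : IsTracialState (M : Set (Op H)) τ) (hA : ∀ x ∈ A, x ∈ M) (i : Fin d) :
    (d : ℝ) * (τ (u i i)).re = 1 := by
  have e : ∀ j, τ (u j j) = τ (u i i) := by
    intro j
    rw [← h.mul j i j, hτ.tracial _ (hA _ (h.mem _ _)) _ (hA _ (h.mem _ _)), h.mul]
  have := congrArg τ h.one
  rw [map_sum, hτ.map_one, Finset.sum_congr rfl (fun j _ => e j)] at this
  have := congrArg Complex.re this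
  simpa using this

/-- In an algebra with matrix units, a minimal projection has small trace. -/
theorem MU.small (h : MU A d u) {M : VonNeumannAlgebra H} {τ : Op H →ₗ[ℂ] ℂ}
    (hτ : IsTracialState (M : Set (Op H)) τ) (hA : ∀ x ∈ A, x ∈ M) {p : Op H} (hp : p ∈ M)
    (hpp : IsProjection p) (hp0 : p ≠ 0) (hmin : ∀ x ∈ M, ∃ t : ℂ, p * x * p = t • p) :
    (d : ℝ) * (τ p).re ≤ 1 := by
  have hex : ∃ i, p * u i i * p ≠ 0 := by
    by_contra! hcon
    apply hp0
    calc p = p * 1 * p := by rw [mul_one, hpp.sq]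
      _ = ∑ i, p * u i i * p := by rw [← h.one, Finset.mul_sum, Finset.sum_mul]
      _ = 0 := Finset.sum_eq_zero fun i _ => hcon i
  obtain ⟨i, hi⟩ := hex
  have hvM : u i i ∈ M := hA _ (h.mem i i)
  have hv := h.proj i
  have htr := h.trace hτ hA i
  generalize u i i = v at *
  obtain ⟨t, ht⟩ := hmin v hvM
  have ht0 : t ≠ 0 := by
    rintro rfl
    exact hi (by rw [ht, zero_smul])
  have htr' : star t = t := by
    have h1 := congrArg star ht
    rw [star_mul, star_mul, hpp.st, hv.st, star_smul, hpp.st, ← mul_assoc, ht] at h1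
    by_contra hne
    have : (star t - t) • p = 0 := by rw [sub_smul, ← h1, sub_self]
    rcases smul_eq_zero.1 this with h2 | h2
    · exact hne (sub_eq_zero.1 h2)
    · exact hp0 h2
  set w := v * p * v with hw
  have hwM : w ∈ M := mul_mem (mul_mem hvM hp) hvM
  have hws : star w = w := by rw [hw, star_mul, star_mul, hpp.st, hv.st, mul_assoc]
  have hvw : v * w = w := by rw [hw, ← mul_assoc, ← mul_assoc, hv.sq]
  have hwv : w * v = w := by rw [hw, mul_assoc, hv.sq]
  have hww : w * w = t • w := by
    calc w * w = v * (p * (v * v) * p) * v := by rw [hw]; noncomm_ring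
      _ = _ := by rw [hv.sq, ht, mul_smul_comm, smul_mul_assoc, hw]
  have hpr : IsProjection (v - t⁻¹ • w) := by
    refine isProj_of ?_ ?_
    · rw [star_sub, star_smul, hv.st, hws, star_inv₀, htr']
    · rw [sub_mul, mul_sub, mul_sub, hv.sq, smul_mul_assoc, mul_smul_comm, hvw, hwv,
        smul_mul_assoc, mul_smul_comm, hww, smul_smul t⁻¹ t, inv_mul_cancel₀ ht0, one_smul]
      abel
  have hτw : τ w = t * τ p := by
    have : τ w = τ (p * v * p) := by
      calc τ w = τ (v * p * (p * v)) := by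
            rw [hw]; congr 1
            calc v * p * v = v * (p * p) * v := by rw [hpp.sq]
              _ = _ := by noncomm_ring
        _ = τ (p * v * (v * p)) := hτ.tracial _ (mul_mem hvM hp) _ (mul_mem hp hvM)
        _ = _ := by
            congr 1
            calc p * v * (v * p) = p * (v * v) * p := by noncomm_ring
              _ = _ := by rw [hv.sq]
    rw [this, ht, map_smul, smul_eq_mul]
  have hpos := (tr_pos hτ (sub_mem hvM (smul_mem' M _ hwM)) (proj_pos hpr)).1
  rw [map_sub, map_smul, hτw, smul_eq_mul, ← mul_assoc, inv_mul_cancel₀ ht0, one_mul,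
    Complex.sub_re] at hpos
  have : (d : ℝ) * (τ p).re ≤ d * (τ v).re := by
    apply mul_le_mul_of_nonneg_left _ (Nat.cast_nonneg d)
    linarith
  linarith

end mu

theorem diffuse {M M1 : VonNeumannAlgebra H} {τ : Op H →ₗ[ℂ] ℂ} {A : ℕ → StarSubalgebra ℂ (Op H)}
    (hτ : IsTracialState (M : Set (Op H)) τ) (hA : ∀ n, ∀ x ∈ A n, x ∈ M)
    (hmu : ∀ n, ∃ u, MU (A n) (2 ^ n) u) (n : ℕ)
    (hM1 : ∀ x, x ∈ M1 ↔ (x ∈ M ∧ ∀ y ∈ A n, y * x = x * y)) :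
    ∀ p ∈ M1, IsProjection p → p ≠ 0 → ∃ x ∈ M1, ∀ t : ℂ, p * x * p ≠ t • p := by
  intro p hp hpp hp0
  by_contra! hcon
  obtain ⟨u, hu⟩ := hmu n
  obtain ⟨hpM, hpc⟩ := (hM1 p).1 hp
  have hcom : ∀ i j, u i j * p = p * u i j := fun i j => hpc _ (hu.mem i j)
  let o : Fin (2 ^ n) := ⟨0, by positivity⟩
  have huM : ∀ i j, u i j ∈ M := fun i j => hA n _ (hu.mem i j)
  set p' := u o o * p with hp'
  have hp'M : p' ∈ M := mul_mem (huM _ _) hpM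
  have hp'p : IsProjection p' := isProj_of (by rw [hp', star_mul, hpp.st, hu.st, hcom])
    (by
      calc u o o * p * (u o o * p) = u o o * (p * u o o) * p := by noncomm_ring
        _ = (u o o * u o o) * (p * p) := by rw [← hcom]; noncomm_ring
        _ = _ := by rw [hu.mul, hpp.sq])
  have hp'0 : p' ≠ 0 := by
    intro h
    apply hp0
    calc p = (∑ i, u i i) * p := by rw [hu.one, one_mul]
      _ = ∑ i, u i o * p' * u o i := by
          rw [Finset.sum_mul]
          refine Finset.sum_congr rfl fun i _ => ?_
          rw [hp', ← mul_assoc, hu.mul, mul_assoc, ← hcom, ← mul_assoc, hu.mul]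
      _ = 0 := by simp [h]
  have hmin : ∀ x ∈ M, ∃ t : ℂ, p' * x * p' = t • p' := by
    intro x hx
    set y := ∑ k, u k o * x * u o k with hy
    have hyM1 : y ∈ M1 := (hM1 y).2 ⟨sum_mem fun k _ => mul_mem (mul_mem (huM _ _) hx) (huM _ _),
      hu.avg x o o⟩
    obtain ⟨t, ht⟩ := hcon y hyM1
    refine ⟨t, ?_⟩
    have e : u o o * y = u o o * x * u o o := by
      rw [hy, Finset.mul_sum, Finset.sum_eq_single o]
      · rw [← mul_assoc, ← mul_assoc, hu.mul]
      · intro k _ hk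
        rw [← mul_assoc, ← mul_assoc, hu.mul0 _ _ _ _ hk.symm, zero_mul, zero_mul]
      · simp
    calc p' * x * p' = (u o o * p) * x * (u o o * p) := rfl
      _ = (p * u o o) * x * (u o o * p) := by rw [← hcom]
      _ = p * (u o o * x * u o o) * p := by noncomm_ring
      _ = u o o * (p * y * p) := by rw [← e, ← mul_assoc, ← hcom]; noncomm_ring
      _ = t • p' := by rw [ht, mul_smul_comm]
  have hpos := tr_proj_pos hτ hp'M hp'p hp'0
  obtain ⟨m, hm⟩ := pow_unbounded_of_one_lt ((τ p').re)⁻¹ (one_lt_two (α := ℝ))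
  obtain ⟨v, hv⟩ := hmu m
  have h1 := hv.small hτ (hA m) hp'M hp'p hp'0 hmin
  push_cast at h1
  have h2 : 1 < 2 ^ m * (τ p').re := by
    rw [inv_lt_iff_one_lt_mul₀ hpos] at hm
    linarith
  linarith

theorem proj_norm {q : Op H} (hqp : IsProjection q) : ‖q‖ ≤ 1 := by
  refine ContinuousLinearMap.opNorm_le_bound _ zero_le_one fun v => ?_
  have := proj_inner hqp v
  have h2 : (inner ℂ (q v) v).re ≤ ‖q v‖ * ‖v‖ := re_inner_le_norm (𝕜 := ℂ) (q v) v
  rcases (norm_nonneg (q v)).eq_or_lt with h0 | h0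
  · rw [← h0]; positivity
  · nlinarith

section ultra
variable {ω : Ultrafilter ℕ} {M Mω : VonNeumannAlgebra H} {τ : Op H →ₗ[ℂ] ℂ}
  {limω : (ℕ → Op H) → Op H}

theorem bdd_const (a : Op H) : Bdd (fun _ : ℕ => a) := ⟨‖a‖, fun _ => le_rfl⟩

theorem bdd_mul {x y : ℕ → Op H} (hx : Bdd x) (hy : Bdd y) : Bdd (fun n => x n * y n) := by
  obtain ⟨C, hC⟩ := hx
  obtain ⟨D, hD⟩ := hy
  have hC0 : 0 ≤ C := (norm_nonneg _).trans (hC 0)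
  exact ⟨C * D, fun n => (norm_mul_le _ _).trans
    (mul_le_mul (hC n) (hD n) (norm_nonneg _) hC0)⟩

theorem bdd_add {x y : ℕ → Op H} (hx : Bdd x) (hy : Bdd y) : Bdd (fun n => x n + y n) := by
  obtain ⟨C, hC⟩ := hx
  obtain ⟨D, hD⟩ := hy
  exact ⟨C + D, fun n => (norm_add_le _ _).trans (add_le_add (hC n) (hD n))⟩

theorem bdd_smul (c : ℂ) {x : ℕ → Op H} (hx : Bdd x) : Bdd (fun n => c • x n) := by
  obtain ⟨C, hC⟩ := hx
  exact ⟨‖c‖ * C, fun n => by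
    rw [norm_smul]
    exact mul_le_mul_of_nonneg_left (hC n) (norm_nonneg _)⟩

theorem bdd_star {x : ℕ → Op H} (hx : Bdd x) : Bdd (fun n => star (x n)) := by
  obtain ⟨C, hC⟩ := hx
  exact ⟨C, fun n => by rw [norm_star]; exact hC n⟩

theorem ev_of_ge (hω : IsFreeUltrafilter ω) {P : ℕ → Prop} (K : ℕ) (h : ∀ n, K ≤ n → P n) :
    ∀ᶠ n in (ω : Filter ℕ), P n := by
  have h1 : {n | n < K} ∉ ω := hω _ (Set.finite_lt_nat K)
  have h2 := Ultrafilter.compl_mem_iff_notMem.2 h1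
  filter_upwards [h2] with n hn
  exact h n (not_lt.1 hn)

theorem lim_congr (hω : IsFreeUltrafilter ω) (hU : IsTracialUltrapower ω M Mω τ limω)
    {x y : ℕ → Op H} (hx : SeqIn (M : Set (Op H)) x) (hxb : Bdd x)
    (hy : SeqIn (M : Set (Op H)) y) (hyb : Bdd y) (K : ℕ) (h : ∀ n, K ≤ n → x n = y n) :
    limω x = limω y := by
  have hy' : SeqIn (M : Set (Op H)) (fun n => (-1 : ℂ) • y n) := fun n => smul_mem' M _ (hy n)
  have hyb' := bdd_smul (-1) hyb
  have h1 := hU.map_add x _ hx hxb hy' hyb'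
  rw [hU.map_smul _ y hy hyb] at h1
  have h2 : limω (fun n => x n + (-1 : ℂ) • y n) = 0 := by
    rw [hU.eq_zero _ (fun n => add_mem (hx n) (hy' n)) (bdd_add hxb hyb')]
    refine tendsto_const_nhds.congr' ?_
    refine ev_of_ge hω K fun n hn => ?_
    simp only [h n hn]
    simp
  rw [h1] at h2
  have : limω x - limω y = 0 := by rw [← h2]; module
  exact sub_eq_zero.1 this

theorem normal_tr (hω : IsFreeUltrafilter ω) (hU : IsTracialUltrapower ω M Mω τ limω)
    (p : ℕ → Op H) (P : Op H) (t : ℝ) (hpM : ∀ k, p k ∈ M) (hp : ∀ k, IsProjection (p k))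
    (hPM : P ∈ M) (hP : IsProjection P) (hlim : ∀ v, Tendsto (fun k => p k v) atTop (nhds (P v)))
    (h1 : ∀ k, P * p k = p k) (h2 : ∀ k m, k ≤ m → p m * p k = p k)
    (ht : ∀ k, (τ (p k)).re ≤ t) : (τ P).re ≤ t := by
  have h1' : ∀ k, p k * P = p k := fun k => by
    have := congrArg star (h1 k)
    rwa [star_mul, hP.st, (hp k).st] at this
  have h2' : ∀ k m, k ≤ m → p k * p m = p k := fun k m hkm => by
    have := congrArg star (h2 k m hkm)
    rwa [star_mul, (hp m).st, (hp k).st] at this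
  set y : ℕ → Op H := fun k => P - p k with hy
  have hyM : SeqIn (M : Set (Op H)) y := fun k => sub_mem hPM (hpM k)
  have hyb : Bdd y := ⟨1 + 1, fun k => (norm_sub_le _ _).trans
    (add_le_add (proj_norm hP) (proj_norm (hp k)))⟩
  set Q := limω y with hQ
  have hc : ∀ a ∈ M, SeqIn (M : Set (Op H)) (fun _ => a) := fun a ha _ => ha
  have hmul : ∀ a ∈ M, limω (fun k => a * y k) = a * Q := fun a ha => by
    rw [hU.map_mul _ y (hc a ha) (bdd_const a) hyM hyb, hU.diag a ha]
  have hpQ : ∀ m, p m * Q = 0 := by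
    intro m
    rw [← hmul _ (hpM m), ← hU.diag 0 (zero_mem M)]
    refine lim_congr hω hU (fun n => mul_mem (hpM m) (hyM n)) (bdd_mul (bdd_const _) hyb)
      (hc 0 (zero_mem M)) (bdd_const 0) m fun n hn => ?_
    rw [hy]
    simp only
    rw [mul_sub, h1', h2' m n hn, sub_self]
  have hPQ0 : P * Q = 0 := by
    ext v
    refine tendsto_nhds_unique (hlim (Q v)) (tendsto_const_nhds.congr fun k => ?_)
    exact (congrArg (fun z : Op H => z v) (hpQ k)).symm
  have hPQ : P * Q = Q := by
    rw [← hmul P hPM]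
    congr 1
    ext1 k
    rw [hy]
    simp only
    rw [mul_sub, hP.sq, h1]
  have hQ0 : Q = 0 := by rw [← hPQ, hPQ0]
  have htr := hU.tr y hyM hyb
  rw [← hQ, hQ0, map_zero] at htr
  have htr' := (Complex.continuous_re.tendsto _).comp htr
  have : (τ P).re - t ≤ 0 := by
    refine ge_of_tendsto' htr' fun k => ?_
    simp only [Function.comp, hy, map_sub, Complex.sub_re]
    have := ht k
    linarith
  linarith

end ultra

theorem index_bound_of {M N : VonNeumannAlgebra H} {τ : Op H →ₗ[ℂ] ℂ} {E : Op H → Op H} {c : ℝ}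
    (hE : IsCondExp τ (M : Set (Op H)) (N : Set (Op H)) E)
    (hfin : HasFiniteIndex (M : Set (Op H)) E) (hc : jonesIndex (M : Set (Op H)) E = c) :
    IndexBound (M : Set (Op H)) E c := by
  have hmem : c ∈ closure {c : ℝ | 0 < c ∧ IndexBound (M : Set (Op H)) E c} := by
    rw [← hc]
    exact csInf_mem_closure hfin ⟨0, fun d hd => hd.1.le⟩
  intro x hx hxp
  have hcl : IsClosed {d : ℝ | (0 : Op H) ≤ d • E x - x} :=
    isClosed_le continuous_const (by fun_prop)
  have := closure_minimal (s := {c : ℝ | 0 < c ∧ IndexBound (M : Set (Op H)) E c}) (fun d hd =>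
    (ContinuousLinearMap.nonneg_iff_isPositive _).2 (hd.2 x hx hxp)) hcl hmem
  exact (ContinuousLinearMap.nonneg_iff_isPositive _).1 this

/-- Let `N ⊆ M` be II₁ factors of finite Jones index `l⁻¹ = [M : N]`,
with `N` the weak closure of ascending matrix subalgebras `A n ≅ M_{2^n}(ℂ)` with
`N = A n ⊗̄ (A n' ∩ N)`, and let `ω` be a free ultrafilter on ℕ. Then there are
projections `e n ∈ A n' ∩ M` with `E_{A n' ∩ N}(e n) = l·1` (hence `E_N (e n) = l·1`),
and `e^ω := (e n)_n` is a projection in `N' ∩ M^ω` with `E_{N^ω}(e^ω) = l·1`. -/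
theorem exists_jones_projection_in_ultrapower
    {H : Type u} [NormedAddCommGroup H] [InnerProductSpace ℂ H] [CompleteSpace H]
    (ω : Ultrafilter ℕ) (hω : IsFreeUltrafilter ω)
    (M N Mω : VonNeumannAlgebra H) (τ : Op H →ₗ[ℂ] ℂ) (limω : (ℕ → Op H) → Op H)
    (l : ℝ) (hl : 0 < l)
    (EN : Op H → Op H) (En : ℕ → Op H → Op H) (Eω : Op H → Op H)
    (A : ℕ → StarSubalgebra ℂ (Op H))
    (hM : IsII1Factor M τ) (hN : IsII1Factor N τ)
    (hNM : (N : Set (Op H)) ⊆ (M : Set (Op H)))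
    (hE : IsCondExp τ (M : Set (Op H)) (N : Set (Op H)) EN)
    (hfin : HasFiniteIndex (M : Set (Op H)) EN)
    (hindex : jonesIndex (M : Set (Op H)) EN = l⁻¹)
    (hmono : Monotone A)
    (hAN : ∀ n, (A n : Set (Op H)) ⊆ (N : Set (Op H)))
    (hmatrix : ∀ n, Nonempty ((A n) ≃⋆ₐ[ℂ] Matrix (Fin (2 ^ n)) (Fin (2 ^ n)) ℂ))
    (hdense : Set.centralizer (Set.centralizer (⋃ n, (A n : Set (Op H)))) =
      (N : Set (Op H)))
    (htensor : ∀ n, Set.centralizer (Set.centralizer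
      ((A n : Set (Op H)) ∪ relComm (A n : Set (Op H)) (N : Set (Op H)))) =
        (N : Set (Op H)))
    (htrace : ∀ n, ∀ a ∈ (A n : Set (Op H)),
      ∀ b ∈ relComm (A n : Set (Op H)) (N : Set (Op H)), τ (a * b) = τ a * τ b)
    (hEn : ∀ n, IsCondExp τ (relComm (A n : Set (Op H)) (M : Set (Op H)))
      (relComm (A n : Set (Op H)) (N : Set (Op H))) (En n))
    (hU : IsTracialUltrapower ω M Mω τ limω)
    (hEω : IsCondExp τ (Mω : Set (Op H)) (ultrapowerSet limω (N : Set (Op H))) Eω) :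
    ∃ e : ℕ → Op H,
      (∀ n, e n ∈ relComm (A n : Set (Op H)) (M : Set (Op H))) ∧
      (∀ n, IsProjection (e n)) ∧
      (∀ n, En n (e n) = (l : ℂ) • (1 : Op H)) ∧
      (∀ n, EN (e n) = (l : ℂ) • (1 : Op H)) ∧
      limω e ∈ relComm (N : Set (Op H)) (Mω : Set (Op H)) ∧
      IsProjection (limω e) ∧
      Eω (limω e) = (l : ℂ) • (1 : Op H) := by

  have hNM' : ∀ x ∈ N, x ∈ M := fun x hx => hNM hx
  have hAN' : ∀ n, ∀ x ∈ A n, x ∈ N := fun n x hx => hAN n hx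
  have hAM : ∀ n, ∀ x ∈ A n, x ∈ M := fun n x hx => hNM' x (hAN' n x hx)
  have hmu : ∀ n, ∃ u, MU (A n) (2 ^ n) u := fun n => exists_MU (A n) _ (hmatrix n).some
  have hc : 0 < l⁻¹ := inv_pos.2 hl
  have hb : IndexBound (M : Set (Op H)) EN l⁻¹ := index_bound_of hE hfin hindex
  have hl1 : l ≤ 1 := by
    have h1 := hb 1 (one_mem M) (ContinuousLinearMap.isPositive_one)
    rw [hE.fix 1 (one_mem N)] at h1
    have h2 := (tr_pos hM.trace (sub_mem (rsmul_mem' M _ (one_mem M)) (one_mem M)) h1).1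
    rw [map_sub, ← Complex.coe_smul, map_smul, hM.trace.map_one] at h2
    simp at h2
    exact (one_le_inv₀ hl).1 h2
  have key : ∀ n, ∃ e, e ∈ relComm (A n : Set (Op H)) (M : Set (Op H)) ∧ IsProjection e ∧
      En n e = (l : ℂ) • (1 : Op H) ∧ EN e = (l : ℂ) • (1 : Op H) := by
    intro n
    obtain ⟨M1, hM1⟩ := exists_relVN M (A n)
    obtain ⟨N1, hN1⟩ := exists_relVN N (A n)
    have hsM : relComm (A n : Set (Op H)) (M : Set (Op H)) = (M1 : Set (Op H)) :=
      Set.ext fun x => (hM1 x).symm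
    have hsN : relComm (A n : Set (Op H)) (N : Set (Op H)) = (N1 : Set (Op H)) :=
      Set.ext fun x => (hN1 x).symm
    have hEn' := hEn n
    rw [hsM, hsN] at hEn'
    obtain ⟨u, hu⟩ := hmu n
    have hprimeM : ∀ a ∈ M, ∀ b ∈ M, (∀ x ∈ M, a * x * b = 0) → a = 0 ∨ b = 0 :=
      fun a ha b _ h => prime_of_factor M hM.factor ha h
    have havg : ∀ (x : Op H), x ∈ M → ∀ i j, (∑ k, u k i * x * u j k) ∈ M := fun x hx i j =>
      sum_mem fun k _ => mul_mem (mul_mem (hAM n _ (hu.mem _ _)) hx) (hAM n _ (hu.mem _ _))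
    have havgN : ∀ (x : Op H), x ∈ N → ∀ i j, (∑ k, u k i * x * u j k) ∈ N := fun x hx i j =>
      sum_mem fun k _ => mul_mem (mul_mem (hAN' n _ (hu.mem _ _)) hx) (hAN' n _ (hu.mem _ _))
    have C : Core M N M1 N1 τ EN l⁻¹ :=
      { hτ := hM.trace
        hE := hE
        hc := hc
        hb := hb
        NM := hNM'
        M1M := fun x hx => ((hM1 x).1 hx).1
        N1N := fun x hx => ((hN1 x).1 hx).1
        N1M1 := fun x hx => (hM1 x).2 ⟨hNM' x ((hN1 x).1 hx).1, ((hN1 x).1 hx).2⟩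
        EM1 := by
          intro x hx
          obtain ⟨h1, h2⟩ := (hM1 x).1 hx
          refine (hN1 _).2 ⟨hE.mem x h1, fun y hy => ?_⟩
          rw [← E_left hE (hAN' n y hy) h1, h2 y hy, E_right hE (hAN' n y hy) h1]
        primeM := hprimeM
        primeN1 := by
          intro a ha b hb' h
          obtain ⟨ha1, ha2⟩ := (hN1 a).1 ha
          refine prime_of_factor N hN.factor ha1 fun x hx => ?_
          have h1 := hu.expand x
          calc a * x * b = a * (∑ p : Fin (2 ^ n) × Fin (2 ^ n),
                u p.1 p.2 * (∑ k, u k p.1 * x * u p.2 k)) * b := by rw [← h1]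
            _ = ∑ p : Fin (2 ^ n) × Fin (2 ^ n),
                a * (u p.1 p.2 * (∑ k, u k p.1 * x * u p.2 k)) * b := by
              rw [Finset.mul_sum, Finset.sum_mul]
            _ = 0 := by
              refine Finset.sum_eq_zero fun p _ => ?_
              have h3 := h (∑ k, u k p.1 * x * u p.2 k) ((hN1 _).2 ⟨havgN x hx _ _, hu.avg x _ _⟩)
              rw [← mul_assoc, ← ha2 _ (hu.mem _ _), mul_assoc, mul_assoc, ← mul_assoc a, h3,
                mul_zero]
        opt := by
          intro d hd hbd
          rw [← hindex]
          exact csInf_le ⟨0, fun d hd => hd.1.le⟩ ⟨hd, hbd⟩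
        gen := by
          intro x hx
          refine ⟨Fin (2 ^ n) × Fin (2 ^ n), inferInstance, fun p => u p.1 p.2,
            fun p => ∑ k, u k p.1 * x * u p.2 k, fun p => ⟨hAN' n _ (hu.mem _ _),
              (hM1 _).2 ⟨havg x hx _ _, hu.avg x _ _⟩,
              fun m hm => ((hM1 m).1 hm).2 _ (hu.mem _ _)⟩, hu.expand x⟩ }
    have hτ1 : IsTracialState (M1 : Set (Op H)) τ :=
      ⟨hM.trace.map_one, fun x hx y hy => hM.trace.tracial x (C.M1M x hx) y (C.M1M y hy),
        fun x hx => hM.trace.pos x (C.M1M x hx), fun x hx => hM.trace.faithful x (C.M1M x hx)⟩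
    obtain ⟨q, hq, hqp, hqt⟩ := exact_proj hτ1 (diffuse hM.trace hAM hmu n hM1)
      (fun p P t a1 a2 a3 a4 a5 a6 a7 a8 => normal_tr hω hU p P t (fun k => C.M1M _ (a1 k)) a2
        (C.M1M _ a3) a4 a5 a6 a7 a8) l hl.le hl1
    obtain ⟨e, he, hep, hEe⟩ := core_exists C hq hqp (by rw [hqt, inv_mul_cancel₀ hl.ne'])
    rw [inv_inv] at hEe
    refine ⟨e, by rw [hsM]; exact he, hep, ?_, hEe⟩
    rw [← hEe]
    have m1 : En n e ∈ N1 := hEn'.mem e he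
    have m2 : EN e ∈ N1 := C.EM1 e he
    have hz : En n e - EN e ∈ N1 := sub_mem m1 m2
    have hzs := star_mem hz
    have h1 : τ (star (En n e - EN e) * En n e) = τ (star (En n e - EN e) * e) := by
      rw [← E_left hEn' hzs he, hEn'.tr _ (mul_mem (C.N1M1 _ hzs) he)]
    have h2 : τ (star (En n e - EN e) * EN e) = τ (star (En n e - EN e) * e) := by
      rw [← E_left hE (C.N1N _ hzs) (C.M1M _ he), hE.tr _ (mul_mem (C.NM _ (C.N1N _ hzs)) (C.M1M _ he))]
    refine sub_eq_zero.1 (hM.trace.faithful _ (C.NM _ (C.N1N _ hz)) ?_)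
    rw [mul_sub, map_sub, h1, h2, sub_self]
  choose e he hep hEne hENe using key
  have heM : SeqIn (M : Set (Op H)) e := fun n => (he n).1
  have heb : Bdd e := ⟨1, fun n => proj_norm (hep n)⟩
  have hQM : limω e ∈ Mω := hU.mem e heM heb
  have hcst : ∀ a ∈ M, SeqIn (M : Set (Op H)) (fun _ => a) := fun a ha _ => ha
  refine ⟨e, he, hep, hEne, hENe, ⟨hQM, ?_⟩, ?_, ?_⟩
  · have hcomm : limω e ∈ Set.centralizer (⋃ n, (A n : Set (Op H))) := by
      intro y hy
      obtain ⟨m, hm⟩ := Set.mem_iUnion.1 hy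
      have hyM : y ∈ M := hAM m y hm
      have e1 := hU.map_mul _ e (hcst y hyM) (bdd_const y) heM heb
      have e2 := hU.map_mul e _ heM heb (hcst y hyM) (bdd_const y)
      rw [hU.diag y hyM] at e1 e2
      rw [← e1, ← e2]
      refine lim_congr hω hU (fun n => mul_mem hyM (heM n)) (bdd_mul (bdd_const _) heb)
        (fun n => mul_mem (heM n) hyM) (bdd_mul heb (bdd_const _)) m fun n hn => ?_
      exact (he n).2 y (hmono hn hm)
    intro y hy
    rw [← hdense] at hy
    exact (hy _ hcomm).symm
  · refine isProj_of ?_ ?_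
    · rw [← hU.map_star e heM heb]
      congr 1
      ext1 n
      exact (hep n).st
    · rw [← hU.map_mul e e heM heb heM heb]
      congr 1
      ext1 n
      exact (hep n).sq
  · obtain ⟨x, hx, hxb, hxe⟩ := hEω.mem _ hQM
    have hxM : SeqIn (M : Set (Op H)) x := fun n => hNM (hx n)
    set z := Eω (limω e) - (l : ℂ) • (1 : Op H) with hz
    have hsc : (-(l : ℂ)) • (1 : Op H) ∈ N := smul_mem' N _ (one_mem N)
    set y : ℕ → Op H := fun n => x n + (-(l : ℂ)) • (1 : Op H) with hy
    have hyN : SeqIn (N : Set (Op H)) y := fun n => add_mem (hx n) hsc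
    have hyM : SeqIn (M : Set (Op H)) y := fun n => hNM (hyN n)
    have hyb : Bdd y := bdd_add hxb (bdd_const _)
    have hylim : limω y = z := by
      rw [hy, hU.map_add x _ hxM hxb (hcst _ (hNM' _ hsc)) (bdd_const _),
        hU.diag _ (hNM' _ hsc), hxe, hz]
      module
    have hsN : SeqIn (N : Set (Op H)) (fun n => star (y n)) := fun n =>
      star_mem (S := VonNeumannAlgebra H) (s := N) (hyN n)
    have hsM : SeqIn (M : Set (Op H)) (fun n => star (y n)) := fun n => hNM (hsN n)
    have hsb := bdd_star hyb
    have hslim : limω (fun n => star (y n)) = star z := by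
      rw [hU.map_star y hyM hyb, hylim]
    have hsz : star z ∈ ultrapowerSet limω (N : Set (Op H)) := ⟨_, hsN, hsb, hslim⟩
    have hszω : star z ∈ Mω := hslim ▸ hU.mem _ hsM hsb
    have h1ω : (1 : Op H) ∈ ultrapowerSet limω (N : Set (Op H)) :=
      ⟨fun _ => 1, fun _ => one_mem N, bdd_const _, hU.diag 1 (one_mem M)⟩
    have t1 : τ (star z * Eω (limω e)) = τ (star z * limω e) := by
      have a1 := hEω.bimod _ hsz _ hQM _ h1ω
      rw [mul_one, mul_one] at a1
      rw [← a1, hEω.tr _ (mul_mem hszω hQM)]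
    have t2 : τ (star z * limω e) = (l : ℂ) * τ (star z) := by
      have a1 := hU.tr _ (fun n => mul_mem (hsM n) (heM n)) (bdd_mul hsb heb)
      rw [hU.map_mul _ _ hsM hsb heM heb, hslim] at a1
      have a2 := (hU.tr _ hsM hsb).const_mul (l : ℂ)
      rw [hslim] at a2
      refine tendsto_nhds_unique a1 (a2.congr fun n => ?_)
      have hm : star (y n) * e n ∈ M := mul_mem (hsM n) (heM n)
      rw [← hE.tr _ hm, E_left hE (hsN n) (heM n), hENe n, mul_smul_comm, mul_one, map_smul,
        smul_eq_mul]
    have hzω : z ∈ Mω := by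
      have := star_mem hszω
      rwa [star_star] at this
    refine sub_eq_zero.1 (hU.traceState.faithful z hzω ?_)
    conv_lhs => rw [hz]
    rw [← hz, mul_sub, map_sub, t1, t2, mul_smul_comm, mul_one, map_smul, smul_eq_mul, sub_self]

end PopaQ
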